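/- arXiv:1809.07795 — 5 statements merged into one kernel-verified Lean document; each statement's English description precedes it below -/
import Mathlib

section
/- Assume ω·sinh β + J·cosh β ≠ 0 and cosh²β < 3. Then the radial function r ↦ V̂^β_{(ω,m,J)}(r, π/2) on (r₀, ∞) has at most two stationary points. It has exactly two stationary points — a strict local maximum at r_max = (m² − √(m²(m² − 3r₀²(ω·sinh β + J·cosh β)²)))/(r₀(ω·sinh β + J·cosh β)²) and a strict local minimum at r_min = (m² + √(m²(m² − 3r₀²(ω·sinh β + J·cosh β)²)))/(r₀(ω·sinh β + J·cosh β)²) — if and only if m² > 3r₀²(ω·sinh β + J·cosh β)², and in that case r₀ < r_max < 3r₀ < r_min. If m² = 3r₀²(ω·sinh β + J·cosh β)², the unique stationary point in (r₀,∞) is at r = 3r₀ and the second radial derivative of V̂^β_{(ω,m,J)}(·, π/2) vanishes there (an inflection point); if m² < 3r₀²(ω·sinh β + J·cosh β)², there are no stationary points in (r₀, ∞). -/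
noncomputable section
open Real Set Filter

/-- The boosted black string potential `V̂^β_{(ω,m,J)}(r,θ)`, with `f(r) = 1 - r₀/r`. -/
def Vhat (r₀ β ω m J r θ : ℝ) : ℝ :=
  ((1 - r₀ / r) / (r ^ 2 * Real.sin θ ^ 2)) * m ^ 2
    - (1 - (1 - r₀ / r)) * (ω * Real.sinh β + J * Real.cosh β) ^ 2 + J ^ 2 - ω ^ 2

/-- `ρ₁ < ρ₂ < ρ₃` are three distinct real roots of `V̂^β_{(ω,m,J)}(·, π/2)` in `(r₀,∞)`. -/
def RootsAt (r₀ β ω m J ρ₁ ρ₂ ρ₃ : ℝ) : Prop :=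
  r₀ < ρ₁ ∧ ρ₁ < ρ₂ ∧ ρ₂ < ρ₃ ∧
    Vhat r₀ β ω m J ρ₁ (Real.pi / 2) = 0 ∧
    Vhat r₀ β ω m J ρ₂ (Real.pi / 2) = 0 ∧
    Vhat r₀ β ω m J ρ₃ (Real.pi / 2) = 0

/-- `V̂^β_{(ω,m,J)}` admits three distinct real roots in `(r₀,∞)`. -/
def ThreeRoots (r₀ β ω m J : ℝ) : Prop :=
  ∃ ρ₁ ρ₂ ρ₃ : ℝ, RootsAt r₀ β ω m J ρ₁ ρ₂ ρ₃

/-- The radial function `r ↦ V̂^β_{(ω,m,J)}(r, π/2)`. -/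
def Vrad (r₀ β ω m J : ℝ) : ℝ → ℝ := fun r => Vhat r₀ β ω m J r (Real.pi / 2)

/-- The coefficient `A = ω·sinh β + J·cosh β`. -/
def Acoef (β ω J : ℝ) : ℝ := ω * Real.sinh β + J * Real.cosh β

/-- The radial coordinate of the local maximum of the potential. -/
def rmaxBS (r₀ β ω m J : ℝ) : ℝ :=
  (m ^ 2 - Real.sqrt (m ^ 2 * (m ^ 2 - 3 * r₀ ^ 2 * (Acoef β ω J) ^ 2))) /
    (r₀ * (Acoef β ω J) ^ 2)

/-- The radial coordinate of the local minimum of the potential. -/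
def rminBS (r₀ β ω m J : ℝ) : ℝ :=
  (m ^ 2 + Real.sqrt (m ^ 2 * (m ^ 2 - 3 * r₀ ^ 2 * (Acoef β ω J) ^ 2))) /
    (r₀ * (Acoef β ω J) ^ 2)

/-- `f` has a strict local maximum at `a`. -/
def StrictLocalMax (f : ℝ → ℝ) (a : ℝ) : Prop :=
  ∀ᶠ x in nhdsWithin a {a}ᶜ, f x < f a

/-- `f` has a strict local minimum at `a`. -/
def StrictLocalMin (f : ℝ → ℝ) (a : ℝ) : Prop :=
  ∀ᶠ x in nhdsWithin a {a}ᶜ, f a < f x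

/-- The numerator of the radial derivative of the potential. -/
def stationaryPoly (r₀ M A r : ℝ) : ℝ :=
  r₀ * A ^ 2 * r ^ 2 - 2 * M * r + 3 * r₀ * M

lemma Vrad_eq (r₀ β ω m J : ℝ) {r : ℝ} (hr : r ≠ 0) :
    Vrad r₀ β ω m J r =
      m ^ 2 / r ^ 2 - r₀ * m ^ 2 / r ^ 3 - r₀ * Acoef β ω J ^ 2 / r + J ^ 2 - ω ^ 2 := by
  simp only [Vrad, Vhat, Acoef, Real.sin_pi_div_two]
  field_simp
  ring

lemma hasDerivAt_Vrad (r₀ β ω m J : ℝ) {r : ℝ} (hr : r ≠ 0) :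
    HasDerivAt (Vrad r₀ β ω m J)
      (stationaryPoly r₀ (m ^ 2) (Acoef β ω J) r / r ^ 4) r := by
  have h2 := (hasDerivAt_const r (m ^ 2)).div (hasDerivAt_pow 2 r) (pow_ne_zero 2 hr)
  have h3 := (hasDerivAt_const r (r₀ * m ^ 2)).div (hasDerivAt_pow 3 r) (pow_ne_zero 3 hr)
  have h1 := (hasDerivAt_const r (r₀ * Acoef β ω J ^ 2)).div (hasDerivAt_id r) hr
  have h := (((h2.sub h3).sub h1).add_const (J ^ 2)).sub_const (ω ^ 2)
  refine (h.congr_of_eventuallyEq ?_).congr_deriv ?_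
  · filter_upwards [isOpen_ne.mem_nhds hr] with x hx
    exact Vrad_eq r₀ β ω m J hx
  · simp only [stationaryPoly, id]
    field_simp
    norm_num
    ring

lemma deriv_Vrad (r₀ β ω m J : ℝ) {r : ℝ} (hr : r ≠ 0) :
    deriv (Vrad r₀ β ω m J) r = stationaryPoly r₀ (m ^ 2) (Acoef β ω J) r / r ^ 4 :=
  (hasDerivAt_Vrad r₀ β ω m J hr).deriv

lemma deriv_Vrad_eq_zero_iff (r₀ β ω m J : ℝ) {r : ℝ} (hr : r ≠ 0) :
    deriv (Vrad r₀ β ω m J) r = 0 ↔ stationaryPoly r₀ (m ^ 2) (Acoef β ω J) r = 0 := by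
  rw [deriv_Vrad r₀ β ω m J hr, div_eq_zero_iff, or_iff_left (pow_ne_zero 4 hr)]

lemma Vrad_sub_of_stationary (r₀ β ω m J : ℝ) {a x : ℝ} (ha : a ≠ 0) (hx : x ≠ 0)
    (h : stationaryPoly r₀ (m ^ 2) (Acoef β ω J) a = 0) :
    Vrad r₀ β ω m J x - Vrad r₀ β ω m J a =
      m ^ 2 * (x - a) ^ 2 / (x ^ 3 * a ^ 3) * (a * x - r₀ * (a + 2 * x)) := by
  rw [Vrad_eq r₀ β ω m J hx, Vrad_eq r₀ β ω m J ha]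
  unfold stationaryPoly at h
  field_simp
  linear_combination x ^ 2 * (x - a) * h

lemma strictLocalMax_Vrad {r₀ β ω m J a : ℝ} (hm : m ≠ 0) (ha : 0 < a) (ha3 : a < 3 * r₀)
    (h : stationaryPoly r₀ (m ^ 2) (Acoef β ω J) a = 0) :
    StrictLocalMax (Vrad r₀ β ω m J) a := by
  have hc : ∀ᶠ x in nhds a, a * x - r₀ * (a + 2 * x) < 0 :=
    ContinuousAt.eventually_lt (by fun_prop) continuousAt_const (by nlinarith)
  filter_upwards [self_mem_nhdsWithin, hc.filter_mono nhdsWithin_le_nhds,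
    (lt_mem_nhds ha).filter_mono nhdsWithin_le_nhds] with x hxa hx hx0
  have hxa' : x - a ≠ 0 := sub_ne_zero.mpr hxa
  rw [← sub_neg, Vrad_sub_of_stationary r₀ β ω m J ha.ne' hx0.ne' h]
  exact mul_neg_of_pos_of_neg (by positivity) hx

lemma strictLocalMin_Vrad {r₀ β ω m J a : ℝ} (hm : m ≠ 0) (ha : 0 < a) (ha3 : 3 * r₀ < a)
    (h : stationaryPoly r₀ (m ^ 2) (Acoef β ω J) a = 0) :
    StrictLocalMin (Vrad r₀ β ω m J) a := by
  have hc : ∀ᶠ x in nhds a, 0 < a * x - r₀ * (a + 2 * x) :=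
    ContinuousAt.eventually_lt continuousAt_const (by fun_prop) (by nlinarith)
  filter_upwards [self_mem_nhdsWithin, hc.filter_mono nhdsWithin_le_nhds,
    (lt_mem_nhds ha).filter_mono nhdsWithin_le_nhds] with x hxa hx hx0
  have hxa' : x - a ≠ 0 := sub_ne_zero.mpr hxa
  rw [← sub_pos, Vrad_sub_of_stationary r₀ β ω m J ha.ne' hx0.ne' h]
  exact mul_pos (by positivity) hx

lemma stationaryPoly_eq_mul {r₀ β ω m J : ℝ} (hr₀ : r₀ ≠ 0) (hA : Acoef β ω J ≠ 0)
    (hm : 3 * r₀ ^ 2 * Acoef β ω J ^ 2 ≤ m ^ 2) (r : ℝ) :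
    stationaryPoly r₀ (m ^ 2) (Acoef β ω J) r =
      r₀ * Acoef β ω J ^ 2 * (r - rmaxBS r₀ β ω m J) * (r - rminBS r₀ β ω m J) := by
  have hs := Real.sq_sqrt (mul_nonneg (sq_nonneg m) (sub_nonneg.mpr hm))
  simp only [stationaryPoly, rmaxBS, rminBS]
  generalize √(m ^ 2 * (m ^ 2 - 3 * r₀ ^ 2 * Acoef β ω J ^ 2)) = s at hs ⊢
  field_simp
  linear_combination hs

lemma stationaryPoly_eq_zero_iff {r₀ β ω m J : ℝ} (hr₀ : r₀ ≠ 0) (hA : Acoef β ω J ≠ 0)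
    (hm : 3 * r₀ ^ 2 * Acoef β ω J ^ 2 ≤ m ^ 2) (r : ℝ) :
    stationaryPoly r₀ (m ^ 2) (Acoef β ω J) r = 0 ↔
      r = rmaxBS r₀ β ω m J ∨ r = rminBS r₀ β ω m J := by
  rw [stationaryPoly_eq_mul hr₀ hA hm, mul_eq_zero, mul_eq_zero, sub_eq_zero, sub_eq_zero,
    or_iff_right (mul_ne_zero hr₀ (pow_ne_zero 2 hA))]

lemma rmaxBS_eq_rminBS {r₀ β ω m J : ℝ} (hm : m ^ 2 ≤ 3 * r₀ ^ 2 * Acoef β ω J ^ 2) :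
    rmaxBS r₀ β ω m J = rminBS r₀ β ω m J := by
  have h : m ^ 2 * (m ^ 2 - 3 * r₀ ^ 2 * Acoef β ω J ^ 2) ≤ 0 :=
    mul_nonpos_of_nonneg_of_nonpos (sq_nonneg m) (sub_nonpos.mpr hm)
  simp [rmaxBS, rminBS, Real.sqrt_eq_zero_of_nonpos h]

lemma stationary_radii_bounds {r₀ β ω m J : ℝ} (hr₀ : 0 < r₀) (hA : Acoef β ω J ≠ 0)
    (hm : 3 * r₀ ^ 2 * Acoef β ω J ^ 2 < m ^ 2) :
    r₀ < rmaxBS r₀ β ω m J ∧ rmaxBS r₀ β ω m J < 3 * r₀ ∧ 3 * r₀ < rminBS r₀ β ω m J := by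
  have hk : 0 < r₀ * Acoef β ω J ^ 2 := by positivity
  have hle : rmaxBS r₀ β ω m J ≤ rminBS r₀ β ω m J := by
    simp only [rmaxBS, rminBS]
    gcongr
    linarith [Real.sqrt_nonneg (m ^ 2 * (m ^ 2 - 3 * r₀ ^ 2 * Acoef β ω J ^ 2))]
  have hmin : r₀ < rminBS r₀ β ω m J := by
    rw [rminBS, lt_div_iff₀ hk]
    nlinarith [Real.sqrt_nonneg (m ^ 2 * (m ^ 2 - 3 * r₀ ^ 2 * Acoef β ω J ^ 2)),
      mul_pos hr₀ hk]
  have hfac := stationaryPoly_eq_mul hr₀.ne' hA hm.le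
  have h3 : 0 < (3 * r₀ - rmaxBS r₀ β ω m J) * (rminBS r₀ β ω m J - 3 * r₀) := by
    refine pos_of_mul_pos_right (a := r₀ * Acoef β ω J ^ 2) ?_ hk.le
    have := hfac (3 * r₀)
    unfold stationaryPoly at this
    nlinarith
  have h1 : 0 < (rmaxBS r₀ β ω m J - r₀) * (rminBS r₀ β ω m J - r₀) := by
    refine pos_of_mul_pos_right (a := r₀ * Acoef β ω J ^ 2) ?_ hk.le
    have := hfac r₀
    unfold stationaryPoly at this
    nlinarith [mul_pos hr₀ hk, mul_pos hr₀ (mul_pos hr₀ hk), mul_nonneg hr₀.le (sq_nonneg m)]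
  refine ⟨sub_pos.mp (pos_of_mul_pos_left h1 (sub_pos.mpr hmin).le), ?_⟩
  rcases mul_pos_iff.mp h3 with h | h <;> constructor <;> linarith [h.1, h.2]

lemma stationaryPoly_of_critical {r₀ M A : ℝ} (h : M = 3 * r₀ ^ 2 * A ^ 2) (r : ℝ) :
    stationaryPoly r₀ M A r = r₀ * A ^ 2 * (r - 3 * r₀) ^ 2 := by
  unfold stationaryPoly
  subst h
  ring

lemma stationaryPoly_pos {r₀ M A : ℝ} (hr₀ : 0 < r₀) (hA : A ≠ 0) (hM : 0 ≤ M)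
    (h : M < 3 * r₀ ^ 2 * A ^ 2) {r : ℝ} (hr : 0 < r) : 0 < stationaryPoly r₀ M A r := by
  have hk : 0 < r₀ * A ^ 2 := by positivity
  refine pos_of_mul_pos_right (a := r₀ * A ^ 2) ?_ hk.le
  have hid : r₀ * A ^ 2 * stationaryPoly r₀ M A r =
      (r₀ * A ^ 2 * r - M) ^ 2 + M * (3 * r₀ ^ 2 * A ^ 2 - M) := by
    unfold stationaryPoly
    ring
  rw [hid]
  rcases hM.eq_or_lt with rfl | hM
  · simp only [sub_zero, zero_mul, add_zero]
    positivity
  · linarith [sq_nonneg (r₀ * A ^ 2 * r - M), mul_pos hM (sub_pos.mpr h)]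

lemma deriv_deriv_Vrad_of_critical {r₀ β ω m J : ℝ} (hr₀ : r₀ ≠ 0)
    (h : m ^ 2 = 3 * r₀ ^ 2 * Acoef β ω J ^ 2) :
    deriv (deriv (Vrad r₀ β ω m J)) (3 * r₀) = 0 := by
  have h3 : 3 * r₀ ≠ 0 := mul_ne_zero three_ne_zero hr₀
  have heq : deriv (Vrad r₀ β ω m J) =ᶠ[nhds (3 * r₀)]
      fun r => r₀ * Acoef β ω J ^ 2 * (r - 3 * r₀) ^ 2 / r ^ 4 := by
    filter_upwards [isOpen_ne.mem_nhds h3] with r hr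
    rw [deriv_Vrad r₀ β ω m J hr, stationaryPoly_of_critical h]
  rw [heq.deriv_eq]
  have hd := (((((hasDerivAt_id (3 * r₀)).sub_const (3 * r₀)).pow 2).const_mul
    (r₀ * Acoef β ω J ^ 2)).div (hasDerivAt_pow 4 (3 * r₀)) (pow_ne_zero 4 h3))
  refine (hd.congr_deriv ?_).deriv
  simp

theorem statement0 (r₀ β ω : ℝ) (m J : ℤ) (hr₀ : 0 < r₀) (hβ : 0 ≤ β)
    (hβ3 : Real.cosh β ^ 2 < 3) (hA : Acoef β ω (J : ℝ) ≠ 0) :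
    -- at most two stationary points on (r₀,∞)
    (∃ a b : ℝ, ∀ r : ℝ, r₀ < r →
        deriv (Vrad r₀ β ω (m : ℝ) (J : ℝ)) r = 0 → r = a ∨ r = b) ∧
    -- exactly two stationary points (strict local max at r_max, strict local min at r_min)
    -- iff m² > 3r₀²(ω sinh β + J cosh β)²
    ((3 * r₀ ^ 2 * (Acoef β ω (J : ℝ)) ^ 2 < (m : ℝ) ^ 2) ↔
      (r₀ < rmaxBS r₀ β ω (m : ℝ) (J : ℝ) ∧ r₀ < rminBS r₀ β ω (m : ℝ) (J : ℝ) ∧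
        rmaxBS r₀ β ω (m : ℝ) (J : ℝ) ≠ rminBS r₀ β ω (m : ℝ) (J : ℝ) ∧
        deriv (Vrad r₀ β ω (m : ℝ) (J : ℝ)) (rmaxBS r₀ β ω (m : ℝ) (J : ℝ)) = 0 ∧
        deriv (Vrad r₀ β ω (m : ℝ) (J : ℝ)) (rminBS r₀ β ω (m : ℝ) (J : ℝ)) = 0 ∧
        StrictLocalMax (Vrad r₀ β ω (m : ℝ) (J : ℝ)) (rmaxBS r₀ β ω (m : ℝ) (J : ℝ)) ∧
        StrictLocalMin (Vrad r₀ β ω (m : ℝ) (J : ℝ)) (rminBS r₀ β ω (m : ℝ) (J : ℝ)) ∧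
        (∀ r : ℝ, r₀ < r → deriv (Vrad r₀ β ω (m : ℝ) (J : ℝ)) r = 0 →
          r = rmaxBS r₀ β ω (m : ℝ) (J : ℝ) ∨ r = rminBS r₀ β ω (m : ℝ) (J : ℝ)))) ∧
    -- in that case, r₀ < r_max < 3r₀ < r_min
    ((3 * r₀ ^ 2 * (Acoef β ω (J : ℝ)) ^ 2 < (m : ℝ) ^ 2) →
      (r₀ < rmaxBS r₀ β ω (m : ℝ) (J : ℝ) ∧ rmaxBS r₀ β ω (m : ℝ) (J : ℝ) < 3 * r₀ ∧
        3 * r₀ < rminBS r₀ β ω (m : ℝ) (J : ℝ))) ∧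
    -- degenerate case: inflection point at r = 3r₀
    (((m : ℝ) ^ 2 = 3 * r₀ ^ 2 * (Acoef β ω (J : ℝ)) ^ 2) →
      ((∀ r : ℝ, r₀ < r →
          (deriv (Vrad r₀ β ω (m : ℝ) (J : ℝ)) r = 0 ↔ r = 3 * r₀)) ∧
        deriv (deriv (Vrad r₀ β ω (m : ℝ) (J : ℝ))) (3 * r₀) = 0)) ∧
    -- no stationary points
    (((m : ℝ) ^ 2 < 3 * r₀ ^ 2 * (Acoef β ω (J : ℝ)) ^ 2) →
      ∀ r : ℝ, r₀ < r → deriv (Vrad r₀ β ω (m : ℝ) (J : ℝ)) r ≠ 0) := by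
  have hM := sq_nonneg (m : ℝ)
  have hpos : ∀ {r : ℝ}, r₀ < r → r ≠ 0 := fun h => (hr₀.trans h).ne'
  have hnone : (m : ℝ) ^ 2 < 3 * r₀ ^ 2 * Acoef β ω J ^ 2 →
      ∀ r : ℝ, r₀ < r → deriv (Vrad r₀ β ω m J) r ≠ 0 := fun hm r hr h =>
    (stationaryPoly_pos hr₀ hA hM hm (hr₀.trans hr)).ne'
      ((deriv_Vrad_eq_zero_iff r₀ β ω m J (hpos hr)).mp h)
  have htwo : ∀ r : ℝ, r₀ < r → deriv (Vrad r₀ β ω m J) r = 0 →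
      r = rmaxBS r₀ β ω m J ∨ r = rminBS r₀ β ω m J := by
    intro r hr h
    rcases lt_or_ge ((m : ℝ) ^ 2) (3 * r₀ ^ 2 * Acoef β ω J ^ 2) with hm | hm
    · exact absurd h (hnone hm r hr)
    · rwa [deriv_Vrad_eq_zero_iff r₀ β ω m J (hpos hr),
        stationaryPoly_eq_zero_iff hr₀.ne' hA hm] at h
  refine ⟨⟨_, _, htwo⟩, ⟨fun hm => ?_, fun h => ?_⟩, stationary_radii_bounds hr₀ hA,
    fun hm => ⟨fun r hr => ?_, deriv_deriv_Vrad_of_critical hr₀.ne' hm⟩, hnone⟩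
  · obtain ⟨h1, h2, h3⟩ := stationary_radii_bounds hr₀ hA hm
    have h4 : r₀ < rminBS r₀ β ω m J := by linarith
    have hm0 : (m : ℝ) ≠ 0 := by
      intro h
      rw [h] at hm
      have : 0 ≤ 3 * r₀ ^ 2 * Acoef β ω J ^ 2 := by positivity
      linarith
    have hmax := (stationaryPoly_eq_zero_iff hr₀.ne' hA hm.le _).mpr (Or.inl rfl)
    have hmin := (stationaryPoly_eq_zero_iff hr₀.ne' hA hm.le _).mpr (Or.inr rfl)
    exact ⟨h1, h4, (h2.trans h3).ne, (deriv_Vrad_eq_zero_iff r₀ β ω m J (hpos h1)).mpr hmax,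
      (deriv_Vrad_eq_zero_iff r₀ β ω m J (hpos h4)).mpr hmin,
      strictLocalMax_Vrad hm0 (hr₀.trans h1) h2 hmax,
      strictLocalMin_Vrad hm0 (hr₀.trans h4) h3 hmin, htwo⟩
  · by_contra hm
    exact h.2.2.1 (rmaxBS_eq_rminBS (not_lt.mp hm))
  · rw [deriv_Vrad_eq_zero_iff r₀ β ω m J (hpos hr), stationaryPoly_of_critical hm,
      mul_eq_zero, or_iff_right (mul_ne_zero hr₀.ne' (pow_ne_zero 2 hA)),
      sq_eq_zero_iff, sub_eq_zero]
end
end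

section
/- Assume cosh²β < 3. Let (ω₀, m₀, J₀), with ω₀ ∈ ℝ, m₀, J₀ ∈ ℤ and ω₀·J₀ > 0, be such that V̂^β_{(ω₀,m₀,J₀)} admits three distinct real roots ρ₁^{ω₀} < ρ₂^{ω₀} < ρ₃^{ω₀} in (r₀, ∞). Then there exist ℰ⁻, ℰ⁺ with 0 < ℰ⁻ < ℰ⁺ < |J₀| such that: (i) |ω₀| ∈ (ℰ⁻, ℰ⁺); (ii) for every ω ∈ ℝ with |ω| ∈ (ℰ⁻, ℰ⁺) and sign(ω) = sign(ω₀), the potential V̂^β_{(ω,m₀,J₀)} admits three distinct real roots in (r₀, ∞); (iii) for any ω₁, ω₂ with |ω₁|, |ω₂| ∈ (ℰ⁻, ℰ⁺), |ω₁| < |ω₂| and sign(ω₁) = sign(ω₂) = sign(ω₀), the roots satisfy ρ₂^{ω₁} > ρ₂^{ω₂} and ρ₃^{ω₁} < ρ₃^{ω₂}, where ρᵢ^{ω} denotes the i-th root of V̂^β_{(ω,m₀,J₀)}. -/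
noncomputable section
open Real Set Filter

/-- The potential on the equator as a cubic polynomial in `x = r₀ / r`. -/
def equatorialCubic (r₀ β ω m J x : ℝ) : ℝ :=
  (m / r₀) ^ 2 * (x ^ 2 * (1 - x)) - (ω * sinh β + J * cosh β) ^ 2 * x + (J ^ 2 - ω ^ 2)

lemma Vhat_pi_div_two_eq {r₀ r : ℝ} (hr₀ : r₀ ≠ 0) (hr : r ≠ 0) (β ω m J : ℝ) :
    Vhat r₀ β ω m J r (π / 2) = equatorialCubic r₀ β ω m J (r₀ / r) := by
  unfold Vhat equatorialCubic
  rw [sin_pi_div_two]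
  field_simp
  ring

lemma cubic_vieta {M B C x y z : ℝ} (hB : B ≠ 0) (hxy : x < y) (hyz : y < z)
    (hx : M * (x ^ 2 * (1 - x)) - B * x + C = 0)
    (hy : M * (y ^ 2 * (1 - y)) - B * y + C = 0)
    (hz : M * (z ^ 2 * (1 - z)) - B * z + C = 0) :
    M ≠ 0 ∧ x + y + z = 1 ∧
      ∀ t, M * (t ^ 2 * (1 - t)) - B * t + C = M * ((x - t) * (y - t) * (z - t)) := by
  have e₁ : M * (x + y - (x ^ 2 + x * y + y ^ 2)) = B :=
    mul_left_cancel₀ (sub_ne_zero.2 hxy.ne') (by linear_combination hy - hx)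
  have e₂ : M * (y + z - (y ^ 2 + y * z + z ^ 2)) = B :=
    mul_left_cancel₀ (sub_ne_zero.2 hyz.ne') (by linear_combination hz - hy)
  have hM : M ≠ 0 := by
    rintro rfl
    exact hB (by simpa using e₁.symm)
  have hsum : x + y + z = 1 :=
    mul_left_cancel₀ (mul_ne_zero hM (sub_ne_zero.2 (hxy.trans hyz).ne'))
      (by linear_combination e₁ - e₂)
  refine ⟨hM, hsum, fun t => ?_⟩
  obtain rfl : z = 1 - x - y := by linarith
  linear_combination hx + (t - x) * e₁

/-- Where the three roots of the cubic lie, in terms of the inverse radii of the roots of the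
potential. -/
lemma RootsAt.cubic_factor {r₀ β ω m J ρ₁ ρ₂ ρ₃ : ℝ} (hr₀ : 0 < r₀) (hβ : 0 ≤ β)
    (hωJ : 0 < ω * J) (h : RootsAt r₀ β ω m J ρ₁ ρ₂ ρ₃) :
    0 < r₀ / ρ₃ ∧ r₀ / ρ₃ < r₀ / ρ₂ ∧ r₀ / ρ₂ < r₀ / ρ₁ ∧ r₀ / ρ₁ < 1 ∧
      r₀ / ρ₃ + r₀ / ρ₂ + r₀ / ρ₁ = 1 ∧ 0 < (m / r₀) ^ 2 ∧
      ∀ t, equatorialCubic r₀ β ω m J t =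
        (m / r₀) ^ 2 * ((r₀ / ρ₃ - t) * (r₀ / ρ₂ - t) * (r₀ / ρ₁ - t)) := by
  obtain ⟨h₁, h₂, h₃, e₁, e₂, e₃⟩ := h
  have p₁ : 0 < ρ₁ := hr₀.trans h₁
  have p₂ := p₁.trans h₂
  have p₃ := p₂.trans h₃
  rw [Vhat_pi_div_two_eq hr₀.ne' (ne_of_gt ‹_›)] at e₁ e₂ e₃
  have l₂₁ := div_lt_div_of_pos_left hr₀ p₁ h₂
  have l₃₂ := div_lt_div_of_pos_left hr₀ p₂ h₃
  have hB : (ω * sinh β + J * cosh β) ^ 2 ≠ 0 := by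
    have hJ : 0 < J ^ 2 := sq_pos_of_ne_zero (right_ne_zero_of_mul hωJ.ne')
    have hs := sinh_nonneg_iff.2 hβ
    have hc := cosh_pos β
    have : 0 < J ^ 2 * cosh β ^ 2 := by positivity
    have : 0 ≤ (ω * J) * sinh β * cosh β := by positivity
    nlinarith [sq_nonneg (ω * sinh β)]
  obtain ⟨hM, hsum, hfac⟩ := cubic_vieta hB l₃₂ l₂₁ e₃ e₂ e₁
  exact ⟨by positivity, l₃₂, l₂₁, (div_lt_one p₁).2 h₁, hsum,
    lt_of_le_of_ne (sq_nonneg _) hM.symm, hfac⟩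

/-- The cubic is strictly decreasing in `|ω|` when `ω` and `J` have the same sign. -/
lemma equatorialCubic_lt {r₀ β ω₁ ω₂ m J x : ℝ} (hβ : 0 ≤ β) (hx : 0 ≤ x)
    (h₁ : 0 < ω₁ * J) (h₂ : 0 < ω₂ * J) (h : |ω₁| < |ω₂|) :
    equatorialCubic r₀ β ω₂ m J x < equatorialCubic r₀ β ω₁ m J x := by
  have hsq := sq_lt_sq.2 h
  have hmul : ω₁ * J ≤ ω₂ * J := by
    rw [← abs_of_pos h₁, ← abs_of_pos h₂, abs_mul, abs_mul]
    gcongr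
  have hs := sinh_nonneg_iff.2 hβ
  have hc := (cosh_pos β).le
  have k₁ : ω₁ ^ 2 * sinh β ^ 2 ≤ ω₂ ^ 2 * sinh β ^ 2 := by gcongr
  have k₂ : ω₁ * J * (sinh β * cosh β) ≤ ω₂ * J * (sinh β * cosh β) := by gcongr
  have k : (ω₁ * sinh β + J * cosh β) ^ 2 * x ≤ (ω₂ * sinh β + J * cosh β) ^ 2 * x :=
    mul_le_mul_of_nonneg_right (by nlinarith) hx
  unfold equatorialCubic
  linarith

lemma equatorialCubic_one_neg {r₀ β ω m J : ℝ} (hβ : 0 ≤ β) (hωJ : 0 < ω * J) :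
    equatorialCubic r₀ β ω m J 1 < 0 := by
  have hs := sinh_nonneg_iff.2 hβ
  have hc := cosh_pos β
  have hω : ω ≠ 0 := left_ne_zero_of_mul hωJ.ne'
  have : 0 < ω ^ 2 * cosh β ^ 2 := by positivity
  have : 0 ≤ ω * J * (sinh β * cosh β) := by positivity
  have : equatorialCubic r₀ β ω m J 1 =
      -(ω ^ 2 * cosh β ^ 2 + 2 * (ω * J * (sinh β * cosh β)) + (J * sinh β) ^ 2) := by
    unfold equatorialCubic
    linear_combination (J ^ 2 - ω ^ 2) * (-cosh_sq β)
  nlinarith [sq_nonneg (J * sinh β)]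

lemma RootsAt.monotone {r₀ β ω₁ ω₂ m J a₁ a₂ a₃ b₁ b₂ b₃ : ℝ} (hr₀ : 0 < r₀) (hβ : 0 ≤ β)
    (h₁ : 0 < ω₁ * J) (h₂ : 0 < ω₂ * J) (h : |ω₁| < |ω₂|)
    (ha : RootsAt r₀ β ω₁ m J a₁ a₂ a₃) (hb : RootsAt r₀ β ω₂ m J b₁ b₂ b₃) :
    b₂ < a₂ ∧ a₃ < b₃ := by
  have pa : 0 < a₂ := hr₀.trans (ha.1.trans ha.2.1)
  have pb : 0 < b₂ := hr₀.trans (hb.1.trans hb.2.1)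
  have pa₃ : 0 < a₃ := pa.trans ha.2.2.1
  have pb₃ : 0 < b₃ := pb.trans hb.2.2.1
  obtain ⟨xa, xa₂, xa₁, -, sa, hM, fa⟩ := ha.cubic_factor hr₀ hβ h₁
  obtain ⟨xb, xb₂, xb₁, -, sb, -, fb⟩ := hb.cubic_factor hr₀ hβ h₂
  rw [← div_lt_div_iff_of_pos_left hr₀ pa pb, ← div_lt_div_iff_of_pos_left hr₀ pb₃ pa₃]
  generalize r₀ / a₁ = u₁ at *
  generalize r₀ / a₂ = u₂ at *
  generalize r₀ / a₃ = u₃ at *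
  generalize r₀ / b₁ = v₁ at *
  generalize r₀ / b₂ = v₂ at *
  generalize r₀ / b₃ = v₃ at *
  have above : ∀ t, 0 ≤ t → (v₃ - t) * (v₂ - t) * (v₁ - t) = 0 →
      0 < (u₃ - t) * (u₂ - t) * (u₁ - t) := by
    intro t ht h0
    have hlt := equatorialCubic_lt (r₀ := r₀) (m := m) hβ ht h₁ h₂ h
    rw [fa, fb, h0, mul_zero] at hlt
    exact (mul_pos_iff_of_pos_left hM).1 hlt
  have below : (v₃ - u₃) * (v₂ - u₃) * (v₁ - u₃) < 0 := by
    have hlt := equatorialCubic_lt (r₀ := r₀) (m := m) hβ xa.le h₁ h₂ h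
    rw [fa, fb, sub_self, zero_mul, zero_mul, mul_zero] at hlt
    exact neg_of_mul_neg_right hlt hM.le
  have lt_or : ∀ t, 0 < (u₃ - t) * (u₂ - t) * (u₁ - t) → t < u₃ ∨ (u₂ < t ∧ t < u₁) := by
    intro t ht
    by_contra! hcon
    obtain ⟨c₁, c₂⟩ := hcon
    rcases le_or_gt t u₂ with c | c
    · have := mul_nonneg (mul_nonneg (sub_nonneg.2 c₁) (sub_nonneg.2 c))
        (sub_nonneg.2 (c.trans xa₁.le))
      linarith
    · have := mul_nonneg (mul_nonneg (sub_nonneg.2 c₁) (sub_nonneg.2 c.le))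
        (sub_nonneg.2 (c₂ c))
      linarith
  have small : v₃ < u₃ := by
    by_contra! hcon
    have := mul_nonneg (mul_nonneg (sub_nonneg.2 hcon) (sub_nonneg.2 (hcon.trans xb₂.le)))
      (sub_nonneg.2 (hcon.trans (xb₂.trans xb₁).le))
    linarith
  have mid := lt_or v₂ (above v₂ (xb.trans xb₂).le (by ring))
  have large := lt_or v₁ (above v₁ (xb.trans (xb₂.trans xb₁)).le (by ring))
  have large' : v₁ < u₁ := large.elim (fun c => by linarith) And.right
  exact ⟨mid.elim (fun c => by linarith) And.left, small⟩

lemma threeRoots_of_sign_changes {r₀ β ω m J s t : ℝ} (hr₀ : 0 < r₀) (hs : 0 < s) (hst : s < t)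
    (ht : t < 1) (h0 : 0 < equatorialCubic r₀ β ω m J 0)
    (h_s : equatorialCubic r₀ β ω m J s < 0) (h_t : 0 < equatorialCubic r₀ β ω m J t)
    (h1 : equatorialCubic r₀ β ω m J 1 < 0) : ThreeRoots r₀ β ω m J := by
  have hcont : Continuous (equatorialCubic r₀ β ω m J) := by
    unfold equatorialCubic
    fun_prop
  obtain ⟨x, hx, ex⟩ := intermediate_value_Ioo' hs.le hcont.continuousOn ⟨h_s, h0⟩
  obtain ⟨y, hy, ey⟩ := intermediate_value_Ioo hst.le hcont.continuousOn ⟨h_s, h_t⟩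
  obtain ⟨z, hz, ez⟩ := intermediate_value_Ioo' ht.le hcont.continuousOn ⟨h1, h_t⟩
  have px : 0 < x := hx.1
  have hxy : x < y := hx.2.trans hy.1
  have hyz : y < z := hy.2.trans hz.1
  have py := px.trans hxy
  have pz := py.trans hyz
  have root : ∀ u, 0 < u → equatorialCubic r₀ β ω m J u = 0 →
      Vhat r₀ β ω m J (r₀ / u) (π / 2) = 0 := by
    intro u hu e
    rw [Vhat_pi_div_two_eq hr₀.ne' (by positivity), div_div_cancel₀ hr₀.ne', e]
  exact ⟨r₀ / z, r₀ / y, r₀ / x, (lt_div_iff₀ pz).2 (mul_lt_of_lt_one_right hr₀ hz.2),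
    div_lt_div_of_pos_left hr₀ py hyz, div_lt_div_of_pos_left hr₀ px hxy,
    root z pz ez, root y py ey, root x px ex⟩

/-- Three roots at `ω₀` persist for all nearby `ω`, since they are simple. -/
lemma RootsAt.eventually_threeRoots {r₀ β ω₀ m J ρ₁ ρ₂ ρ₃ : ℝ} (hr₀ : 0 < r₀) (hβ : 0 ≤ β)
    (hωJ : 0 < ω₀ * J) (h : RootsAt r₀ β ω₀ m J ρ₁ ρ₂ ρ₃) :
    |ω₀| < |J| ∧ ∀ᶠ ω in nhds ω₀, ThreeRoots r₀ β ω m J := by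
  obtain ⟨p₃, l₃₂, l₂₁, l₁, -, hM, hfac⟩ := h.cubic_factor hr₀ hβ hωJ
  obtain ⟨s, hs, hs'⟩ := exists_between l₃₂
  obtain ⟨t, ht, ht'⟩ := exists_between l₂₁
  have q0 : 0 < equatorialCubic r₀ β ω₀ m J 0 := by
    rw [hfac]
    have := p₃.trans l₃₂
    have := this.trans l₂₁
    simp only [sub_zero]
    positivity
  have qs : equatorialCubic r₀ β ω₀ m J s < 0 := by
    rw [hfac]
    exact mul_neg_of_pos_of_neg hM (mul_neg_of_neg_of_pos
      (mul_neg_of_neg_of_pos (by linarith) (by linarith)) (by linarith))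
  have qt : 0 < equatorialCubic r₀ β ω₀ m J t := by
    rw [hfac]
    exact mul_pos hM (mul_pos (mul_pos_of_neg_of_neg (by linarith) (by linarith))
      (by linarith))
  have hcont : ∀ x, Continuous fun ω => equatorialCubic r₀ β ω m J x := by
    intro x
    unfold equatorialCubic
    fun_prop
  refine ⟨sq_lt_sq.1 (by simpa [equatorialCubic] using q0), ?_⟩
  filter_upwards [(hcont 0).continuousAt.eventually (lt_mem_nhds q0),
    (hcont s).continuousAt.eventually (gt_mem_nhds qs),
    (hcont t).continuousAt.eventually (lt_mem_nhds qt),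
    (hcont 1).continuousAt.eventually (gt_mem_nhds (equatorialCubic_one_neg hβ hωJ))]
    with ω h0 h_s h_t h1
  exact threeRoots_of_sign_changes hr₀ (p₃.trans hs) (hs'.trans ht) (ht'.trans l₁) h0 h_s h_t h1

lemma abs_sub_eq_abs_abs_sub_abs {a b : ℝ} (h : 0 < a * b) : |a - b| = |(|a| - |b|)| := by
  rcases mul_pos_iff.1 h with ⟨ha, hb⟩ | ⟨ha, hb⟩
  · rw [abs_of_pos ha, abs_of_pos hb]
  · rw [abs_of_neg ha, abs_of_neg hb, ← abs_neg (a - b)]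
    congr 1
    ring

theorem statement4 (r₀ β ω₀ : ℝ) (m₀ J₀ : ℤ) (hr₀ : 0 < r₀) (hβ : 0 ≤ β)
    (hβ3 : Real.cosh β ^ 2 < 3)
    (hsign : ω₀ * (J₀ : ℝ) > 0)
    (ρ₁ ρ₂ ρ₃ : ℝ) (hroots : RootsAt r₀ β ω₀ (m₀ : ℝ) (J₀ : ℝ) ρ₁ ρ₂ ρ₃) :
    ∃ Em Ep : ℝ, 0 < Em ∧ Em < Ep ∧ Ep < |(J₀ : ℝ)| ∧
      -- (i) |ω₀| ∈ (ℰ⁻, ℰ⁺)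
      (Em < |ω₀| ∧ |ω₀| < Ep) ∧
      -- (ii) for every ω with |ω| ∈ (ℰ⁻, ℰ⁺) and sign(ω) = sign(ω₀), three distinct roots exist
      (∀ ω : ℝ, Em < |ω| → |ω| < Ep → 0 < ω * ω₀ →
        ThreeRoots r₀ β ω (m₀ : ℝ) (J₀ : ℝ)) ∧
      -- (iii) monotonicity of the second and third roots
      (∀ ω₁ ω₂ a₁ a₂ a₃ b₁ b₂ b₃ : ℝ,
        Em < |ω₁| → |ω₁| < Ep → Em < |ω₂| → |ω₂| < Ep → |ω₁| < |ω₂| →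
        0 < ω₁ * ω₀ → 0 < ω₂ * ω₀ →
        RootsAt r₀ β ω₁ (m₀ : ℝ) (J₀ : ℝ) a₁ a₂ a₃ →
        RootsAt r₀ β ω₂ (m₀ : ℝ) (J₀ : ℝ) b₁ b₂ b₃ →
        b₂ < a₂ ∧ a₃ < b₃) := by
  obtain ⟨hlt, hev⟩ := hroots.eventually_threeRoots hr₀ hβ hsign
  obtain ⟨δ, hδ, hball⟩ := Metric.eventually_nhds_iff.1 hev
  have hω₀ : 0 < |ω₀| := abs_pos.2 (left_ne_zero_of_mul hsign.ne')
  obtain ⟨ε, hε, hεmin⟩ := exists_between (lt_min hδ (lt_min hω₀ (sub_pos.2 hlt)))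
  obtain ⟨hε₁, hε₂, hε₃⟩ : ε < δ ∧ ε < |ω₀| ∧ ε < |(J₀ : ℝ)| - |ω₀| := by
    simpa only [lt_min_iff] using hεmin
  have same_sign : ∀ ω : ℝ, 0 < ω * ω₀ → 0 < ω * (J₀ : ℝ) := by
    intro ω hω
    have hpos : 0 < (ω * J₀) * ω₀ ^ 2 := by
      calc 0 < (ω * ω₀) * (ω₀ * J₀) := mul_pos hω hsign
        _ = (ω * J₀) * ω₀ ^ 2 := by ring
    exact pos_of_mul_pos_left hpos (sq_nonneg _)
  refine ⟨|ω₀| - ε, |ω₀| + ε, by linarith, by linarith, by linarith,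
    ⟨by linarith, by linarith⟩, fun ω h₁ h₂ hω => hball ?_, ?_⟩
  · rw [Real.dist_eq, abs_sub_eq_abs_abs_sub_abs hω, abs_lt]
    constructor <;> linarith
  · intro ω₁ ω₂ a₁ a₂ a₃ b₁ b₂ b₃ _ _ _ _ h hω₁ hω₂ ha hb
    exact ha.monotone hr₀ hβ (same_sign ω₁ hω₁) (same_sign ω₂ hω₂) h hb
end
end

section
/- Let Ω be a bounded open set in the (r*,θ)-plane with r > 3r₀ at every point of Ω. Then there exists M > 0 such that for all m, J ∈ ℤ with m² > M and J² > M, and every real function ψ, smooth on a neighbourhood of the closure of Ω, not identically zero, with ψ = 0 on ∂Ω, one has ∫_Ω ψ·(−g(r)·(∂²_{r*}ψ + ∂²_θ ψ) + (V_j + V^β_{(0,m,J)})·ψ) dr* dθ > 0. In particular, ω = 0 is not a Dirichlet eigenfrequency of the boosted-string problem on Ω for such m, J. -/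
noncomputable section
open Real Set Filter MeasureTheory

/-- `f(r) = 1 - r₀/r`. -/
def fS (r₀ r : ℝ) : ℝ := 1 - r₀ / r

/-- `g(r) = f(r)/r²`. -/
def gS (r₀ r : ℝ) : ℝ := fS r₀ r / r ^ 2

/-- `V_j(r,θ) = −(r−r₀)/(4r³sin²θ) − r₀²/(16r⁴)`. -/
def VjS (r₀ r θ : ℝ) : ℝ :=
  -((r - r₀) / (4 * r ^ 3 * Real.sin θ ^ 2)) - r₀ ^ 2 / (16 * r ^ 4)

/-- Second partial derivative in the first variable. -/
def d2x (u : ℝ × ℝ → ℝ) (p : ℝ × ℝ) : ℝ := deriv (deriv (fun s => u (s, p.2))) p.1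

/-- Second partial derivative in the second variable. -/
def d2y (u : ℝ × ℝ → ℝ) (p : ℝ × ℝ) : ℝ := deriv (deriv (fun s => u (p.1, s))) p.2

/-- `u` is smooth on an open neighbourhood of the closure of `Ω`. -/
def SmoothNearClosure (u : ℝ × ℝ → ℝ) (Ω : Set (ℝ × ℝ)) : Prop :=
  ∃ U : Set (ℝ × ℝ), IsOpen U ∧ closure Ω ⊆ U ∧ ContDiffOn ℝ (⊤ : ℕ∞) u U

/-- Euclidean distance in the plane. -/
def eudist (x y : ℝ × ℝ) : ℝ := Real.sqrt ((x.1 - y.1) ^ 2 + (x.2 - y.2) ^ 2)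

/-- The boosted black string potential
`V^β_{(ω,m,J)}(r,θ) = (f/(r²sin²θ))m² − ((1−f)sinh²β)ω² − 2(1−f)sinhβcoshβ·ωJ + (1−(1−f)cosh²β)J²`. -/
def VB (r₀ β ω m J r θ : ℝ) : ℝ :=
  (fS r₀ r / (r ^ 2 * Real.sin θ ^ 2)) * m ^ 2
    - ((1 - fS r₀ r) * Real.sinh β ^ 2) * ω ^ 2
    - 2 * (1 - fS r₀ r) * Real.sinh β * Real.cosh β * ω * J
    + (1 - (1 - fS r₀ r) * Real.cosh β ^ 2) * J ^ 2

/-- `ω` is a Dirichlet eigenfrequency of the boosted-string problem on `Ω`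
with frequencies `m`, `J`. -/
def BoostEigFreq (r₀ β : ℝ) (ρ : ℝ → ℝ) (Ω : Set (ℝ × ℝ)) (m J ω : ℝ) : Prop :=
  ∃ u : ℝ × ℝ → ℝ, SmoothNearClosure u Ω ∧ (∃ x ∈ Ω, u x ≠ 0) ∧
    (∀ x ∈ frontier Ω, u x = 0) ∧
    ∀ p ∈ Ω,
      -gS r₀ (ρ p.1) * (d2x u p + d2y u p)
          + (VjS r₀ (ρ p.1) p.2 + VB r₀ β ω m J (ρ p.1) p.2) * u p
        = ω ^ 2 * u p

/-- `f` is continuous and bounded on `Ω`. -/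
def BddContOn (f : ℝ × ℝ → ℝ) (Ω : Set (ℝ × ℝ)) : Prop :=
  ContinuousOn f Ω ∧ ∃ C, ∀ x ∈ Ω, |f x| ≤ C

namespace BddContOn

variable {f h : ℝ × ℝ → ℝ} {Ω : Set (ℝ × ℝ)}

theorem const (c : ℝ) : BddContOn (fun _ => c) Ω :=
  ⟨continuousOn_const, |c|, fun _ _ => le_rfl⟩

theorem mul (hf : BddContOn f Ω) (hh : BddContOn h Ω) : BddContOn (fun x => f x * h x) Ω := by
  obtain ⟨hf, C, hC⟩ := hf
  obtain ⟨hh, D, hD⟩ := hh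
  refine ⟨hf.mul hh, C * D, fun x hx => ?_⟩
  rw [abs_mul]
  exact mul_le_mul (hC x hx) (hD x hx) (abs_nonneg _) ((abs_nonneg _).trans (hC x hx))

theorem add (hf : BddContOn f Ω) (hh : BddContOn h Ω) : BddContOn (fun x => f x + h x) Ω := by
  obtain ⟨hf, C, hC⟩ := hf
  obtain ⟨hh, D, hD⟩ := hh
  exact ⟨hf.add hh, C + D, fun x hx => (abs_add_le _ _).trans (add_le_add (hC x hx) (hD x hx))⟩

theorem sub (hf : BddContOn f Ω) (hh : BddContOn h Ω) : BddContOn (fun x => f x - h x) Ω := by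
  obtain ⟨hf, C, hC⟩ := hf
  obtain ⟨hh, D, hD⟩ := hh
  exact ⟨hf.sub hh, C + D, fun x hx => (abs_sub _ _).trans (add_le_add (hC x hx) (hD x hx))⟩

theorem congr (hf : BddContOn f Ω) (h_eq : ∀ x ∈ Ω, h x = f x) : BddContOn h Ω := by
  obtain ⟨hf, C, hC⟩ := hf
  exact ⟨hf.congr h_eq, C, fun x hx => by rw [h_eq x hx]; exact hC x hx⟩

theorem of_continuousOn_closure (hΩ : Bornology.IsBounded Ω) (hf : ContinuousOn f (closure Ω)) :
    BddContOn f Ω := by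
  obtain ⟨C, hC⟩ := hΩ.isCompact_closure.exists_bound_of_continuousOn hf
  exact ⟨hf.mono subset_closure, C, fun x hx => hC x (subset_closure hx)⟩

theorem integrableOn (hf : BddContOn f Ω) (hΩ : IsOpen Ω) (hb : Bornology.IsBounded Ω) :
    IntegrableOn f Ω := by
  obtain ⟨hf, C, hC⟩ := hf
  refine IntegrableOn.of_bound hb.measure_lt_top (hf.aestronglyMeasurable hΩ.measurableSet) C ?_
  filter_upwards [ae_restrict_mem hΩ.measurableSet] with x hx using hC x hx

end BddContOn

/-- Bounded `C¹` truncations of the identity that vanish near zero. -/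
theorem exists_truncation : ∃ (φ φ' : ℕ → ℝ → ℝ) (C : ℝ),
    (∀ n t, HasDerivAt (φ n) (φ' n t) t) ∧ (∀ n, Continuous (φ' n)) ∧
    (∀ (n : ℕ) t, (n : ℝ) * t ^ 2 < 1 → φ n t = 0) ∧ (∀ n t, |φ n t| ≤ |t|) ∧
    (∀ n t, |φ' n t| ≤ C) ∧ (∀ t, ∀ᶠ n in atTop, φ n t = t) ∧
    (∀ t, ∀ᶠ n in atTop, φ' n t = if t = 0 then 0 else 1) := by
  have hσd : ∀ u, HasDerivAt smoothTransition (deriv smoothTransition u) u := fun u =>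
    ((smoothTransition.contDiff (n := 1)).differentiable (by norm_num) u).hasDerivAt
  have hσc : Continuous (deriv smoothTransition) :=
    (smoothTransition.contDiff (n := 1)).continuous_deriv (by norm_num)
  set F : ℝ → ℝ := fun u => smoothTransition u + 2 * (u + 1) * deriv smoothTransition u with hF
  have hFc : Continuous F := by
    have := smoothTransition.continuous
    fun_prop
  have hF0 : ∀ u < 0, F u = 0 := fun u hu => by
    have : smoothTransition =ᶠ[nhds u] fun _ => 0 := by
      filter_upwards [Iio_mem_nhds hu] with v hv using smoothTransition.zero_of_nonpos (le_of_lt hv)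
    simp [hF, this.deriv_eq, this.eq_of_nhds]
  have hF1 : ∀ u > 1, F u = 1 := fun u hu => by
    have : smoothTransition =ᶠ[nhds u] fun _ => 1 := by
      filter_upwards [Ioi_mem_nhds hu] with v hv using smoothTransition.one_of_one_le (le_of_lt hv)
    simp [hF, this.deriv_eq, this.eq_of_nhds]
  obtain ⟨C, hC⟩ := (isCompact_Icc (a := (0 : ℝ)) (b := 1)).exists_bound_of_continuousOn
    hFc.continuousOn
  have hlarge : ∀ t : ℝ, t ≠ 0 → ∀ᶠ n : ℕ in atTop, 1 < (n : ℝ) * t ^ 2 - 1 := fun t ht => by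
    have : Tendsto (fun n : ℕ => (n : ℝ) * t ^ 2) atTop atTop :=
      tendsto_natCast_atTop_atTop.atTop_mul_const (by positivity)
    filter_upwards [this.eventually_gt_atTop 2] with n hn
    linarith
  refine ⟨fun n t => t * smoothTransition (n * t ^ 2 - 1), fun n t => F (n * t ^ 2 - 1), max C 1,
    fun n t => ?_, fun n => by fun_prop, fun n t ht => ?_, fun n t => ?_, fun n t => ?_,
    fun t => ?_, fun t => ?_⟩
  · have h1 : HasDerivAt (fun t : ℝ => (n : ℝ) * t ^ 2 - 1) (n * (2 * t)) t := by
      simpa using ((hasDerivAt_pow 2 t).const_mul (n : ℝ)).sub_const 1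
    refine ((hasDerivAt_id t).mul ((hσd _).comp t h1)).congr_deriv ?_
    simp only [hF, id, Function.comp_apply]
    ring
  · simp [smoothTransition.zero_of_nonpos (by linarith : (n : ℝ) * t ^ 2 - 1 ≤ 0)]
  · rw [abs_mul, abs_of_nonneg (smoothTransition.nonneg _)]
    exact mul_le_of_le_one_right (abs_nonneg _) (smoothTransition.le_one _)
  · beta_reduce
    rcases lt_or_ge ((n : ℝ) * t ^ 2 - 1) 0 with h | h
    · rw [hF0 _ h]; simp
    · rcases le_or_gt ((n : ℝ) * t ^ 2 - 1) 1 with h' | h'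
      · exact (hC _ ⟨h, h'⟩).trans (le_max_left _ _)
      · rw [hF1 _ h']; simp
  · by_cases ht : t = 0
    · simp [ht]
    · filter_upwards [hlarge t ht] with n hn
      rw [smoothTransition.one_of_one_le hn.le, mul_one]
  · by_cases ht : t = 0
    · filter_upwards with n
      rw [if_pos ht]
      exact hF0 _ (by simp [ht])
    · filter_upwards [hlarge t ht] with n hn
      rw [if_neg ht]
      exact hF1 _ hn

/-- The integral of a directional derivative of a function vanishing near every point outside an
open set is zero. -/
theorem setIntegral_lineDeriv_eq_zero {Ω : Set (ℝ × ℝ)} (hΩ : IsOpen Ω) {w w' : ℝ × ℝ → ℝ}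
    {v : ℝ × ℝ} (hw : IntegrableOn w Ω) (hw' : IntegrableOn w' Ω)
    (hd : ∀ x ∈ Ω, HasLineDerivAt ℝ w (w' x) x v)
    (h0 : ∀ x ∉ Ω, ∀ᶠ y in nhdsWithin x Ω, w y = 0) : ∫ x in Ω, w' x = 0 := by
  have hder : ∀ x, HasLineDerivAt ℝ (Ω.indicator w) (Ω.indicator w' x) x v := fun x => by
    by_cases hx : x ∈ Ω
    · rw [indicator_of_mem hx]
      refine (hd x hx).congr_of_eventuallyEq ?_
      filter_upwards [hΩ.mem_nhds hx] with y hy using indicator_of_mem hy w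
    · rw [indicator_of_notMem hx]
      refine ((hasFDerivAt_const (0 : ℝ) x).hasLineDerivAt v).congr_of_eventuallyEq ?_
      filter_upwards [eventually_nhdsWithin_iff.1 (h0 x hx)] with y hy
      by_cases hyΩ : y ∈ Ω
      · rw [indicator_of_mem hyΩ, hy hyΩ]
      · rw [indicator_of_notMem hyΩ]
  have key := integral_bilinear_hasLineDerivAt_right_eq_neg_left_of_integrable
    (μ := (volume : Measure (ℝ × ℝ))) (f := fun _ => (1 : ℝ)) (f' := fun _ => 0)
    (g := Ω.indicator w) (g' := Ω.indicator w') (v := v) (B := ContinuousLinearMap.mul ℝ ℝ)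
    (by simp) (by simpa using hw'.integrable_indicator hΩ.measurableSet)
    (by simpa using hw.integrable_indicator hΩ.measurableSet)
    (fun x _ => (hasFDerivAt_const (1 : ℝ) x).hasLineDerivAt v) (fun x _ => hder x)
  simpa [integral_indicator hΩ.measurableSet] using key

/-- Integration by parts against a function with zero boundary values, on an arbitrary bounded open
set. -/
theorem setIntegral_mul_lineDeriv_add_eq_zero {Ω : Set (ℝ × ℝ)} (hΩ : IsOpen Ω)
    (hb : Bornology.IsBounded Ω) {ψ p b b' : ℝ × ℝ → ℝ} {v : ℝ × ℝ}
    (hψ : BddContOn ψ Ω) (hψ0 : ∀ x ∉ Ω, Tendsto ψ (nhdsWithin x Ω) (nhds 0))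
    (hp : BddContOn p Ω) (hbb : BddContOn b Ω) (hbb' : BddContOn b' Ω)
    (hψd : ∀ x ∈ Ω, HasLineDerivAt ℝ ψ (p x) x v)
    (hbd : ∀ x ∈ Ω, HasLineDerivAt ℝ b (b' x) x v) :
    ∫ x in Ω, (ψ x * b' x + (if ψ x = 0 then 0 else 1) * (p x * b x)) = 0 := by
  obtain ⟨φ, φ', C, hφd, hφ'c, hφ0, hφle, hφ'le, hφlim, hφ'lim⟩ := exists_truncation
  have hφψ : ∀ n, BddContOn (fun x => φ n (ψ x)) Ω := fun n => by
    obtain ⟨hc, D, hD⟩ := hψ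
    have : Continuous (φ n) := continuous_iff_continuousAt.2 fun t => (hφd n t).continuousAt
    exact ⟨this.comp_continuousOn hc, D, fun x hx => (hφle n _).trans (hD x hx)⟩
  have hφ'ψ : ∀ n, BddContOn (fun x => φ' n (ψ x)) Ω := fun n =>
    ⟨(hφ'c n).comp_continuousOn hψ.1, C, fun x _ => hφ'le n _⟩
  have hF : ∀ n, BddContOn (fun x => φ n (ψ x) * b' x + φ' n (ψ x) * (p x * b x)) Ω := fun n =>
    ((hφψ n).mul hbb').add ((hφ'ψ n).mul (hp.mul hbb))
  have hzero : ∀ n, ∫ x in Ω, (φ n (ψ x) * b' x + φ' n (ψ x) * (p x * b x)) = 0 := fun n => by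
    refine setIntegral_lineDeriv_eq_zero hΩ (w := fun x => φ n (ψ x) * b x) (v := v)
      (((hφψ n).mul hbb).integrableOn hΩ hb) ((hF n).integrableOn hΩ hb) (fun x hx => ?_)
      (fun x hx => ?_)
    · have h1 : HasDerivAt (fun t : ℝ => φ n (ψ (x + t • v))) (φ' n (ψ x) * p x) 0 :=
        HasDerivAt.comp_of_eq (h₂ := φ n) 0 (hφd n (ψ x)) (hψd x hx) (by simp)
      refine HasDerivAt.congr_deriv (h1.mul (hbd x hx)) ?_
      simp only [zero_smul, add_zero]
      ring
    · have hlim : Tendsto (fun y => (n : ℝ) * ψ y ^ 2) (nhdsWithin x Ω) (nhds 0) := by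
        simpa using ((hψ0 x hx).pow 2).const_mul (n : ℝ)
      filter_upwards [hlim.eventually_lt_const one_pos] with y hy
      rw [hφ0 n _ hy, zero_mul]
  obtain ⟨Dψ, hDψ⟩ := hψ.2
  obtain ⟨D1, hD1⟩ := hbb'.2
  obtain ⟨D2, hD2⟩ := (hp.mul hbb).2
  have hlim := tendsto_integral_of_dominated_convergence (μ := volume.restrict Ω)
    (F := fun n x => φ n (ψ x) * b' x + φ' n (ψ x) * (p x * b x))
    (f := fun x => ψ x * b' x + (if ψ x = 0 then 0 else 1) * (p x * b x))
    (fun _ => Dψ * D1 + C * D2) (fun n => ((hF n).integrableOn hΩ hb).1)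
    ((BddContOn.const _).integrableOn hΩ hb)
    (fun n => by
      filter_upwards [ae_restrict_mem hΩ.measurableSet] with x hx
      rw [norm_eq_abs]
      refine (abs_add_le _ _).trans ?_
      rw [abs_mul, abs_mul (φ' n (ψ x))]
      have h1 := (hφle n (ψ x)).trans (hDψ x hx)
      have h2 := hφ'le n (ψ x)
      exact add_le_add
        (mul_le_mul h1 (hD1 x hx) (abs_nonneg _) ((abs_nonneg _).trans h1))
        (mul_le_mul h2 (hD2 x hx) (abs_nonneg _) ((abs_nonneg _).trans h2)))
    (Eventually.of_forall fun x => by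
      refine tendsto_const_nhds.congr' ?_
      filter_upwards [hφlim (ψ x), hφ'lim (ψ x)] with n h1 h2
      rw [h1, h2])
  simp only [hzero] at hlim
  exact (tendsto_nhds_unique hlim tendsto_const_nhds)

/-- A function with zero boundary values and bounded directional derivative is controlled by the
distance to the complement along the given direction. -/
theorem abs_le_mul_of_add_smul_notMem {Ω : Set (ℝ × ℝ)} (hΩ : IsOpen Ω) {ψ p : ℝ × ℝ → ℝ}
    {v : ℝ × ℝ} {C : ℝ} (hψ : ContinuousOn ψ (closure Ω)) (hψ0 : ∀ x ∈ frontier Ω, ψ x = 0)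
    (hp : ∀ x ∈ Ω, |p x| ≤ C) (hψd : ∀ x ∈ Ω, HasLineDerivAt ℝ ψ (p x) x v)
    {x : ℝ × ℝ} (hx : x ∈ Ω) {T : ℝ} (hT : 0 ≤ T) (hxT : x + T • v ∉ Ω) : |ψ x| ≤ C * T := by
  have hγ : Continuous fun t : ℝ => x + t • v := by fun_prop
  obtain ⟨t₀, ⟨ht₀, ht₀Ω⟩, hmin⟩ := (isCompact_Icc.inter_right
    (hΩ.isClosed_compl.preimage hγ)).exists_isLeast ⟨T, ⟨hT, le_rfl⟩, hxT⟩
  have hin : ∀ t ∈ Ico 0 t₀, x + t • v ∈ Ω := fun t ht => by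
    by_contra h
    exact absurd (hmin ⟨⟨ht.1, ht.2.le.trans ht₀.2⟩, h⟩) (not_le.2 ht.2)
  have ht₀pos : 0 < t₀ := by
    refine lt_of_le_of_ne ht₀.1 fun h => ht₀Ω ?_
    simpa [← h] using hx
  have hcl : ∀ t ∈ Icc 0 t₀, x + t • v ∈ closure Ω := fun t ht => by
    have : t ∈ closure (Ico 0 t₀) := by rwa [closure_Ico ht₀pos.ne]
    exact map_mem_closure (f := fun t : ℝ => x + t • v) hγ this hin
  have hend : ψ (x + t₀ • v) = 0 := hψ0 _ <| by
    rw [hΩ.frontier_eq]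
    exact ⟨hcl t₀ ⟨ht₀.1, le_rfl⟩, ht₀Ω⟩
  have hmv := norm_image_sub_le_of_norm_deriv_right_le_segment (a := 0) (b := t₀)
    (f := fun t : ℝ => ψ (x + t • v)) (f' := fun t => p (x + t • v)) (C := C)
    (hψ.comp hγ.continuousOn hcl)
    (fun t ht => by
      have h : HasDerivAt (fun s : ℝ => ψ (x + t • v + s • v)) (p (x + t • v)) (t - t) := by
        rw [sub_self]; exact hψd _ (hin t ht)
      have h2 := h.comp_sub_const t t
      refine (h2.congr_of_eventuallyEq (Eventually.of_forall fun s => ?_)).hasDerivWithinAt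
      simp only [sub_smul]
      congr 1
      abel)
    (fun t ht => hp _ (hin t ht)) t₀ ⟨ht₀.1, le_rfl⟩
  have hC : 0 ≤ C := (abs_nonneg _).trans (hp x hx)
  simp only [hend, zero_smul, add_zero, zero_sub, norm_neg, sub_zero, norm_eq_abs] at hmv
  exact hmv.trans (mul_le_mul_of_nonneg_left ht₀.2 hC)

theorem SmoothNearClosure.exists_partials {ψ : ℝ × ℝ → ℝ} {Ω : Set (ℝ × ℝ)}
    (hψ : SmoothNearClosure ψ Ω) (hb : Bornology.IsBounded Ω) :
    ContinuousOn ψ (closure Ω) ∧ ∃ P Q : ℝ × ℝ → ℝ,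
      BddContOn P Ω ∧ BddContOn Q Ω ∧ BddContOn (d2x ψ) Ω ∧ BddContOn (d2y ψ) Ω ∧
      (∀ x ∈ Ω, HasLineDerivAt ℝ ψ (P x) x (1, 0)) ∧
      (∀ x ∈ Ω, HasLineDerivAt ℝ P (d2x ψ x) x (1, 0)) ∧
      (∀ x ∈ Ω, HasLineDerivAt ℝ ψ (Q x) x (0, 1)) ∧
      (∀ x ∈ Ω, HasLineDerivAt ℝ Q (d2y ψ x) x (0, 1)) := by
  obtain ⟨U, hU, hΩU, hψ⟩ := hψ
  have hsub : Ω ⊆ U := subset_closure.trans hΩU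
  have smooth_partial : ∀ (u : ℝ × ℝ → ℝ) (v : ℝ × ℝ), ContDiffOn ℝ (⊤ : ℕ∞) u U →
      ContDiffOn ℝ (⊤ : ℕ∞) (fun x => fderiv ℝ u x v) U := fun u v hu =>
    (hu.fderiv_of_isOpen hU (by simp)).clm_apply contDiffOn_const
  have hdiff : ∀ (u : ℝ × ℝ → ℝ), ContDiffOn ℝ (⊤ : ℕ∞) u U → ∀ x ∈ U,
      HasFDerivAt u (fderiv ℝ u x) x := fun u hu x hx =>
    ((hu.differentiableOn (by simp)).differentiableAt (hU.mem_nhds hx)).hasFDerivAt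
  have hbdd : ∀ (u : ℝ × ℝ → ℝ), ContDiffOn ℝ (⊤ : ℕ∞) u U → BddContOn u Ω := fun u hu =>
    BddContOn.of_continuousOn_closure hb (hu.continuousOn.mono hΩU)
  have derivx : ∀ (u : ℝ × ℝ → ℝ), ContDiffOn ℝ (⊤ : ℕ∞) u U → ∀ x ∈ U,
      HasDerivAt (fun s => u (s, x.2)) (fderiv ℝ u x (1, 0)) x.1 := fun u hu x hx =>
    HasFDerivAt.comp_hasDerivAt (l := u) (f := fun s : ℝ => (s, x.2)) x.1 (hdiff u hu x hx)
      ((hasDerivAt_id x.1).prodMk (hasDerivAt_const x.1 x.2))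
  have derivy : ∀ (u : ℝ × ℝ → ℝ), ContDiffOn ℝ (⊤ : ℕ∞) u U → ∀ x ∈ U,
      HasDerivAt (fun s => u (x.1, s)) (fderiv ℝ u x (0, 1)) x.2 := fun u hu x hx =>
    HasFDerivAt.comp_hasDerivAt (l := u) (f := fun s : ℝ => (x.1, s)) x.2 (hdiff u hu x hx)
      ((hasDerivAt_const x.2 x.1).prodMk (hasDerivAt_id x.2))
  have hx1 := smooth_partial ψ (1, 0) hψ
  have hy1 := smooth_partial ψ (0, 1) hψ
  have hx2 := smooth_partial _ (1, 0) hx1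
  have hy2 := smooth_partial _ (0, 1) hy1
  have d2x_eq : ∀ x ∈ Ω, d2x ψ x = fderiv ℝ (fun y => fderiv ℝ ψ y (1, 0)) x (1, 0) :=
    fun x hx => by
    refine (HasDerivAt.congr_of_eventuallyEq (derivx _ hx1 x (hsub hx)) ?_).deriv
    have : ∀ᶠ s in nhds x.1, (s, x.2) ∈ U :=
      ContinuousAt.eventually_mem (f := fun s => (s, x.2)) (by fun_prop) (hU.mem_nhds (hsub hx))
    filter_upwards [this] with s hs using (derivx ψ hψ _ hs).deriv
  have d2y_eq : ∀ x ∈ Ω, d2y ψ x = fderiv ℝ (fun y => fderiv ℝ ψ y (0, 1)) x (0, 1) :=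
    fun x hx => by
    refine (HasDerivAt.congr_of_eventuallyEq (derivy _ hy1 x (hsub hx)) ?_).deriv
    have : ∀ᶠ s in nhds x.2, (x.1, s) ∈ U :=
      ContinuousAt.eventually_mem (f := fun s => (x.1, s)) (by fun_prop) (hU.mem_nhds (hsub hx))
    filter_upwards [this] with s hs using (derivy ψ hψ _ hs).deriv
  refine ⟨hψ.continuousOn.mono hΩU, fun x => fderiv ℝ ψ x (1, 0), fun x => fderiv ℝ ψ x (0, 1),
    hbdd _ hx1, hbdd _ hy1, (hbdd _ hx2).congr d2x_eq, (hbdd _ hy2).congr d2y_eq,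
    fun x hx => (hdiff _ hψ x (hsub hx)).hasLineDerivAt _, fun x hx => ?_,
    fun x hx => (hdiff _ hψ x (hsub hx)).hasLineDerivAt _, fun x hx => ?_⟩
  · rw [d2x_eq x hx]
    exact (hdiff _ hx1 x (hsub hx)).hasLineDerivAt _
  · rw [d2y_eq x hx]
    exact (hdiff _ hy1 x (hsub hx)).hasLineDerivAt _

theorem fS_pos {r₀ r : ℝ} (hr₀ : 0 < r₀) (hr : r₀ < r) : 0 < fS r₀ r := by
  rw [fS, sub_pos, div_lt_one (hr₀.trans hr)]
  exact hr

theorem hasDerivAt_fS {r₀ r : ℝ} (hr : r ≠ 0) : HasDerivAt (fS r₀) (r₀ / r ^ 2) r := by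
  have := ((hasDerivAt_inv hr).const_mul r₀).const_sub 1
  refine (this.congr_deriv (by ring)).congr_of_eventuallyEq (Eventually.of_forall fun s => ?_)
  simp [fS, div_eq_mul_inv]

/-- The radius as a function of the tortoise coordinate. -/
theorem hasDerivAt_radius {r₀ : ℝ} (hr₀ : 0 < r₀) {rs ρ : ℝ → ℝ}
    (hrs : ∀ r ∈ Set.Ioi r₀, HasDerivAt rs (1 / (r * Real.sqrt (fS r₀ r))) r)
    (hρ : ∀ r ∈ Set.Ioi r₀, ρ (rs r) = r) {r : ℝ} (hr : r₀ < r) :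
    HasDerivAt ρ (r * Real.sqrt (fS r₀ r)) (rs r) := by
  have hrpos : 0 < r := hr₀.trans hr
  have hne : r * Real.sqrt (fS r₀ r) ≠ 0 :=
    (mul_pos hrpos (Real.sqrt_pos.2 (fS_pos hr₀ hr))).ne'
  have hstrict : HasStrictDerivAt rs (1 / (r * Real.sqrt (fS r₀ r))) r := by
    refine hasStrictDerivAt_of_hasDerivAt_of_continuousAt
      (f' := fun r => 1 / (r * Real.sqrt (fS r₀ r))) ?_ ?_
    · filter_upwards [Ioi_mem_nhds hr] with s hs using hrs s hs
    · exact continuousAt_const.div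
        (continuousAt_id.mul (hasDerivAt_fS hrpos.ne').continuousAt.sqrt) hne
  have hinv := (hstrict.to_local_left_inverse (one_div_ne_zero hne) (g := ρ) (by
    filter_upwards [Ioi_mem_nhds hr] with s hs using hρ s hs)).hasDerivAt
  exact hinv.congr_deriv (by simp)

/-- The derivative of `g` with respect to the tortoise coordinate. -/
theorem hasDerivAt_gS_radius {r₀ : ℝ} (hr₀ : 0 < r₀) {rs ρ : ℝ → ℝ}
    (hrs : ∀ r ∈ Set.Ioi r₀, HasDerivAt rs (1 / (r * Real.sqrt (fS r₀ r))) r)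
    (hρ : ∀ r ∈ Set.Ioi r₀, ρ (rs r) = r) {r : ℝ} (hr : r₀ < r) :
    HasDerivAt (fun x => gS r₀ (ρ x)) (Real.sqrt (fS r₀ r) / r * ((3 * (r₀ / r) - 2) / r))
      (rs r) := by
  have hr0 : r ≠ 0 := (hr₀.trans hr).ne'
  have hg := (hasDerivAt_fS (r₀ := r₀) hr0).div (hasDerivAt_pow 2 r) (pow_ne_zero 2 hr0)
  refine (HasDerivAt.comp_of_eq (h₂ := gS r₀) (rs r) hg (hasDerivAt_radius hr₀ hrs hρ hr)
    (hρ r hr).symm).congr_deriv ?_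
  rw [show fS r₀ r = 1 - r₀ / r from rfl]
  generalize Real.sqrt (1 - r₀ / r) = k
  field_simp
  push_cast
  ring

/-- Completing the square for the first-order cross term. -/
theorem cross_term_bound {r₀ r : ℝ} (hr₀ : 0 < r₀) (hr : 3 * r₀ < r) (a p : ℝ) :
    -(a ^ 2 / r ^ 2) ≤
      a * (Real.sqrt (fS r₀ r) / r * ((3 * (r₀ / r) - 2) / r) * p) + p * (gS r₀ r * p) := by
  have hf := fS_pos hr₀ (by linarith : r₀ < r)
  have hg : gS r₀ r = (Real.sqrt (fS r₀ r) / r) ^ 2 := by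
    rw [div_pow, Real.sq_sqrt hf.le, gS]
  rw [hg]
  generalize Real.sqrt (fS r₀ r) / r = k
  have hs : 0 < r₀ / r := div_pos hr₀ (by linarith)
  have hs' : r₀ / r < 1 / 3 := by rw [div_lt_iff₀ (by linarith)]; linarith
  generalize r₀ / r = s at hs hs'
  have e1 : a ^ 2 / r ^ 2 = (a / r) ^ 2 := by rw [div_pow]
  have e2 : a * (k * ((3 * s - 2) / r) * p) = (a / r) * (3 * s - 2) * (k * p) := by ring
  rw [e1, e2]
  generalize a / r = q
  have h3 : (3 * s - 2) ^ 2 ≤ 4 := by nlinarith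
  nlinarith [sq_nonneg (k * p + q * (3 * s - 2) / 2), mul_le_mul_of_nonneg_left h3 (sq_nonneg q)]

theorem potential_eq {r₀ r : ℝ} (hr : r ≠ 0) (β m J θ : ℝ) :
    VjS r₀ r θ + VB r₀ β 0 m J r θ =
      (m ^ 2 - 1 / 4) * (fS r₀ r * (r⁻¹ * (Real.sin θ)⁻¹) ^ 2) - r₀ ^ 2 / 16 * r⁻¹ ^ 4
        + (1 - r₀ * r⁻¹ * Real.cosh β ^ 2) * J ^ 2 := by
  have h : (r - r₀) / (4 * r ^ 3 * Real.sin θ ^ 2) =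
      1 / 4 * (1 - r₀ / r) * (r⁻¹ * (Real.sin θ)⁻¹) ^ 2 := by
    by_cases hs : Real.sin θ = 0
    · simp [hs]
    · field_simp
  rw [VjS, VB, h, fS]
  have h2 : (1 - r₀ / r) / (r ^ 2 * Real.sin θ ^ 2) =
      (1 - r₀ / r) * (r⁻¹ * (Real.sin θ)⁻¹) ^ 2 := by
    rw [div_eq_mul_inv, mul_inv, mul_pow, inv_pow, inv_pow]
  rw [h2]
  ring

theorem potential_lower_bound {r₀ r : ℝ} (hr₀ : 0 < r₀) (hr : 3 * r₀ < r) {m : ℝ}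
    (hm : 1 / 4 < m ^ 2) (β J θ : ℝ) :
    (1 - Real.cosh β ^ 2 / 3) * J ^ 2 - 2 / r₀ ^ 2 ≤
      VjS r₀ r θ + VB r₀ β 0 m J r θ - 1 / r ^ 2 := by
  have hrpos : 0 < r := by linarith
  have hf := fS_pos hr₀ (by linarith : r₀ < r)
  rw [potential_eq hrpos.ne', show 1 / r ^ 2 = r⁻¹ ^ 2 by rw [inv_pow, one_div]]
  have h1 : 0 ≤ (m ^ 2 - 1 / 4) * (fS r₀ r * (r⁻¹ * (Real.sin θ)⁻¹) ^ 2) :=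
    mul_nonneg (by linarith) (mul_nonneg hf.le (sq_nonneg _))
  have ht : 0 < r⁻¹ := inv_pos.2 hrpos
  have hs : r₀ * r⁻¹ ≤ 1 / 3 := by
    rw [← div_eq_mul_inv, div_le_iff₀ hrpos]; linarith
  have h2 : (1 - Real.cosh β ^ 2 / 3) * J ^ 2 ≤ (1 - r₀ * r⁻¹ * Real.cosh β ^ 2) * J ^ 2 :=
    mul_le_mul_of_nonneg_right
      (by nlinarith [mul_le_mul_of_nonneg_right hs (sq_nonneg (Real.cosh β))]) (sq_nonneg _)
  have hs2 : (r₀ * r⁻¹) ^ 2 ≤ 1 := by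
    have : 0 < r₀ * r⁻¹ := mul_pos hr₀ ht
    nlinarith
  have h3 : r⁻¹ ^ 2 ≤ 1 / r₀ ^ 2 := by
    rw [le_div_iff₀ (by positivity)]
    linarith [mul_pow r₀ r⁻¹ 2]
  have h4 : r₀ ^ 2 / 16 * r⁻¹ ^ 4 ≤ r⁻¹ ^ 2 := by
    have := mul_le_mul_of_nonneg_right hs2 (sq_nonneg r⁻¹)
    nlinarith [sq_nonneg (r₀ * r⁻¹ * r⁻¹)]
  have h5 : 2 / r₀ ^ 2 = 1 / r₀ ^ 2 + 1 / r₀ ^ 2 := by ring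
  linarith

theorem setIntegral_quadratic_form_pos {r₀ β : ℝ} (hr₀ : 0 < r₀) {rs ρ : ℝ → ℝ}
    (hrs : ∀ r ∈ Set.Ioi r₀, HasDerivAt rs (1 / (r * Real.sqrt (fS r₀ r))) r)
    (hρ : ∀ r ∈ Set.Ioi r₀, ρ (rs r) = r)
    {Ω : Set (ℝ × ℝ)} (hΩ : IsOpen Ω) (hb : Bornology.IsBounded Ω)
    (hΩsub : Ω ⊆ (rs '' Set.Ioi (3 * r₀)) ×ˢ Set.Ioo 0 Real.pi) {m J : ℝ} (hm : 1 / 4 < m ^ 2)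
    (hJ : 2 / r₀ ^ 2 < (1 - Real.cosh β ^ 2 / 3) * J ^ 2) {ψ : ℝ × ℝ → ℝ}
    (hψ : SmoothNearClosure ψ Ω) (hne : ∃ x ∈ Ω, ψ x ≠ 0) (hψ0 : ∀ x ∈ frontier Ω, ψ x = 0) :
    0 < ∫ p in Ω, ψ p * (-gS r₀ (ρ p.1) * (d2x ψ p + d2y ψ p)
      + (VjS r₀ (ρ p.1) p.2 + VB r₀ β 0 m J (ρ p.1) p.2) * ψ p) := by
  obtain ⟨hψc, P, Q, hP, hQ, hxx, hyy, hψP, hPx, hψQ, hQy⟩ := hψ.exists_partials hb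
  have hψb : BddContOn ψ Ω := .of_continuousOn_closure hb hψc
  have hrad : ∀ x ∈ Ω, 3 * r₀ < ρ x.1 ∧ rs (ρ x.1) = x.1 := fun x hx => by
    obtain ⟨r, hr, hrx⟩ := (hΩsub hx).1
    have hr' : 3 * r₀ < r := hr
    rw [← hrx, hρ r (show r₀ < r by linarith)]
    exact ⟨hr', rfl⟩
  have hlt : ∀ x ∈ Ω, r₀ < ρ x.1 := fun x hx => by linarith [(hrad x hx).1]
  have hpos : ∀ x ∈ Ω, 0 < ρ x.1 := fun x hx => hr₀.trans (hlt x hx)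
  have hsin : ∀ x ∈ Ω, 0 < Real.sin x.2 := fun x hx =>
    Real.sin_pos_of_pos_of_lt_pi (hΩsub hx).2.1 (hΩsub hx).2.2
  have hρc : ContinuousOn (fun x : ℝ × ℝ => ρ x.1) Ω := fun x hx => by
    have := (hasDerivAt_radius hr₀ hrs hρ (hlt x hx)).continuousAt
    rw [(hrad x hx).2] at this
    exact (ContinuousAt.comp (f := Prod.fst) this continuousAt_fst).continuousWithinAt
  have hinv : BddContOn (fun x => (ρ x.1)⁻¹) Ω := by
    refine ⟨hρc.inv₀ fun x hx => (hpos x hx).ne', r₀⁻¹, fun x hx => ?_⟩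
    rw [abs_of_pos (inv_pos.2 (hpos x hx))]
    exact inv_anti₀ hr₀ (hlt x hx).le
  have hf : BddContOn (fun x => fS r₀ (ρ x.1)) Ω :=
    ((BddContOn.const 1).sub ((BddContOn.const r₀).mul hinv)).congr fun x _ => by
      rw [fS, div_eq_mul_inv]
  have hsqrt : BddContOn (fun x => Real.sqrt (fS r₀ (ρ x.1))) Ω := by
    obtain ⟨hc, C, hC⟩ := hf
    refine ⟨hc.sqrt, Real.sqrt C, fun x hx => ?_⟩
    rw [abs_of_nonneg (Real.sqrt_nonneg _)]
    exact Real.sqrt_le_sqrt ((le_abs_self _).trans (hC x hx))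
  set G : ℝ × ℝ → ℝ := fun x => gS r₀ (ρ x.1) with hGdef
  set G' : ℝ × ℝ → ℝ := fun x =>
    Real.sqrt (fS r₀ (ρ x.1)) / ρ x.1 * ((3 * (r₀ / ρ x.1) - 2) / ρ x.1) with hG'def
  have hG : BddContOn G Ω := (hf.mul (hinv.mul hinv)).congr fun x _ => by
    simp only [hGdef, gS, div_eq_mul_inv, sq, mul_inv]
  have hG' : BddContOn G' Ω :=
    ((hsqrt.mul hinv).mul ((((BddContOn.const 3).mul ((BddContOn.const r₀).mul hinv)).sub
      (BddContOn.const 2)).mul hinv)).congr fun x _ => by simp only [hG'def, div_eq_mul_inv]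
  have hGx : ∀ x ∈ Ω, HasLineDerivAt ℝ G (G' x) x (1, 0) := fun x hx => by
    have h := hasDerivAt_gS_radius hr₀ hrs hρ (hlt x hx)
    rw [(hrad x hx).2] at h
    have h1 : HasDerivAt (fun t : ℝ => x.1 + t) 1 0 := (hasDerivAt_id 0).const_add x.1
    have h2 := HasDerivAt.comp_of_eq (h₂ := fun y => gS r₀ (ρ y)) 0 h h1 (by simp)
    refine (h2.congr_deriv (mul_one _)).congr_of_eventuallyEq (Eventually.of_forall fun t => ?_)
    simp [hGdef]
  have hGy : ∀ x, HasLineDerivAt ℝ G 0 x (0, 1) := fun x => by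
    refine (hasDerivAt_const (0 : ℝ) (G x)).congr_of_eventuallyEq (Eventually.of_forall fun t => ?_)
    simp [hGdef]
  have htend : ∀ x ∉ Ω, Tendsto ψ (nhdsWithin x Ω) (nhds 0) := fun x hx => by
    by_cases hxc : x ∈ closure Ω
    · have := (hψc x hxc).mono subset_closure
      rwa [ContinuousWithinAt, hψ0 x (by rw [hΩ.frontier_eq]; exact ⟨hxc, hx⟩)] at this
    · rw [notMem_closure_iff_nhdsWithin_eq_bot.1 hxc]
      exact tendsto_bot
  have hmulderiv : ∀ {R : ℝ × ℝ → ℝ} {g r s : ℝ} {x v : ℝ × ℝ}, HasLineDerivAt ℝ G g x v →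
      HasLineDerivAt ℝ R r x v → s = G x * r + g * R x →
      HasLineDerivAt ℝ (fun y => G y * R y) s x v := fun h1 h2 hs => by
    refine HasDerivAt.congr_deriv (HasDerivAt.mul h1 h2) ?_
    simp only [zero_smul, add_zero, hs]
    ring
  have hbx' : BddContOn (fun x => G x * d2x ψ x + G' x * P x) Ω := (hG.mul hxx).add (hG'.mul hP)
  have hby' : BddContOn (fun x => G x * d2y ψ x) Ω := hG.mul hyy
  have hIx := setIntegral_mul_lineDeriv_add_eq_zero hΩ hb hψb htend hP (hG.mul hP) hbx' hψP
    (fun x hx => hmulderiv (hGx x hx) (hPx x hx) rfl)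
  have hIy := setIntegral_mul_lineDeriv_add_eq_zero hΩ hb hψb htend hQ (hG.mul hQ) hby' hψQ
    (fun x hx => hmulderiv (hGy x) (hQy x hx) (by ring))
  -- the boundary condition compensates the singularity of the potential on the axis
  have hψsin : BddContOn (fun x => ψ x * (Real.sin x.2)⁻¹) Ω := by
    obtain ⟨C, hC⟩ := hQ.2
    refine ⟨hψb.1.mul ((Real.continuous_sin.comp continuous_snd).continuousOn.inv₀
      fun x hx => (hsin x hx).ne'), C * (Real.pi / 2), fun x hx => ?_⟩
    have hC0 : 0 ≤ C := (abs_nonneg _).trans (hC x hx)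
    have hx2 := (hΩsub hx).2
    have key : |ψ x| ≤ C * (Real.pi / 2 * Real.sin x.2) := by
      rcases le_total x.2 (Real.pi / 2) with h | h
      · have h1 := abs_le_mul_of_add_smul_notMem hΩ hψc hψ0 (v := (0, -1)) (p := fun y => -Q y)
          (fun y hy => by rw [abs_neg]; exact hC y hy)
          (fun y hy => by
            have := HasDerivAt.scomp_of_eq (h := fun t : ℝ => -t) (0 : ℝ) (hψQ y hy)
              (hasDerivAt_neg 0) (by simp)
            refine (this.congr_deriv (by simp)).congr_of_eventuallyEq
              (Eventually.of_forall fun t => ?_)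
            simp) hx hx2.1.le
          (fun hmem => by simpa using (hΩsub hmem).2.1)
        refine h1.trans (mul_le_mul_of_nonneg_left ?_ hC0)
        have := Real.mul_le_sin hx2.1.le h
        calc x.2 = Real.pi / 2 * (2 / Real.pi * x.2) := by field_simp
          _ ≤ _ := mul_le_mul_of_nonneg_left this (by positivity)
      · have h1 := abs_le_mul_of_add_smul_notMem hΩ hψc hψ0 hC hψQ hx (sub_nonneg.2 hx2.2.le)
          (fun hmem => by simpa using (hΩsub hmem).2.2)
        refine h1.trans (mul_le_mul_of_nonneg_left ?_ hC0)
        have := Real.mul_le_sin (sub_nonneg.2 hx2.2.le) (by linarith)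
        rw [Real.sin_pi_sub] at this
        calc Real.pi - x.2 = Real.pi / 2 * (2 / Real.pi * (Real.pi - x.2)) := by field_simp
          _ ≤ _ := mul_le_mul_of_nonneg_left this (by positivity)
    rw [abs_mul, abs_of_pos (inv_pos.2 (hsin x hx)), ← div_eq_mul_inv, div_le_iff₀ (hsin x hx)]
    linarith
  set W : ℝ × ℝ → ℝ := fun x => VjS r₀ (ρ x.1) x.2 + VB r₀ β 0 m J (ρ x.1) x.2 with hWdef
  have hW : BddContOn (fun x => ψ x * (W x * ψ x)) Ω := by
    have hrψ := hinv.mul hψsin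
    have hi2 := hinv.mul hinv
    refine (((((BddContOn.const (m ^ 2 - 1 / 4)).mul (hf.mul (hrψ.mul hrψ)))).sub
      ((BddContOn.const (r₀ ^ 2 / 16)).mul ((hi2.mul hi2).mul (hψb.mul hψb)))).add
      (((BddContOn.const (J ^ 2)).mul ((BddContOn.const 1).sub
        ((BddContOn.const (r₀ * Real.cosh β ^ 2)).mul hinv))).mul (hψb.mul hψb))).congr
      fun x hx => ?_
    simp only [hWdef, potential_eq (hpos x hx).ne']
    ring
  have hform : BddContOn (fun p => ψ p * (-G p * (d2x ψ p + d2y ψ p) + W p * ψ p)) Ω :=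
    (hW.sub (hψb.mul (hG.mul (hxx.add hyy)))).congr fun x _ => by ring
  set δ := (1 - Real.cosh β ^ 2 / 3) * J ^ 2 - 2 / r₀ ^ 2 with hδ
  have hδpos : 0 < δ := sub_pos.2 hJ
  have hlow : BddContOn (fun x => δ * (ψ x * ψ x)) Ω := (BddContOn.const δ).mul (hψb.mul hψb)
  have hlowpos : 0 < ∫ x in Ω, δ * (ψ x * ψ x) := by
    rw [setIntegral_pos_iff_support_of_nonneg_ae
      (Eventually.of_forall fun x => mul_nonneg hδpos.le (mul_self_nonneg _))
      (hlow.integrableOn hΩ hb)]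
    obtain ⟨x, hx, hxne⟩ := hne
    have hopen : IsOpen (Ω ∩ ψ ⁻¹' {0}ᶜ) :=
      hψb.1.isOpen_inter_preimage hΩ isOpen_compl_singleton
    refine (hopen.measure_pos volume ⟨x, hx, hxne⟩).trans_le (measure_mono fun y hy => ⟨?_, hy.1⟩)
    exact mul_ne_zero hδpos.ne' (mul_ne_zero hy.2 hy.2)
  have hchi : ∀ {R : ℝ × ℝ → ℝ}, BddContOn R Ω →
      IntegrableOn (fun x => (if ψ x = 0 then 0 else 1) * (R x * (G x * R x))) Ω := fun {R} hR => by
    have hmeas : MeasurableSet (Ω ∩ ψ ⁻¹' {0}ᶜ) :=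
      (hψb.1.isOpen_inter_preimage hΩ isOpen_compl_singleton).measurableSet
    refine (((hR.mul (hG.mul hR)).integrableOn hΩ hb).indicator hmeas).congr_fun (fun x hx => ?_)
      hΩ.measurableSet
    by_cases h : ψ x = 0
    · simp [h]
    · simp [h, hx, indicator]
  have hix : IntegrableOn (fun x => ψ x * (G x * d2x ψ x + G' x * P x)
      + (if ψ x = 0 then 0 else 1) * (P x * (G x * P x))) Ω :=
    ((hψb.mul hbx').integrableOn hΩ hb).add (hchi hP)
  have hiy : IntegrableOn (fun x => ψ x * (G x * d2y ψ x)
      + (if ψ x = 0 then 0 else 1) * (Q x * (G x * Q x))) Ω :=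
    ((hψb.mul hby').integrableOn hΩ hb).add (hchi hQ)
  have hixy : IntegrableOn (fun x => (ψ x * (G x * d2x ψ x + G' x * P x)
      + (if ψ x = 0 then 0 else 1) * (P x * (G x * P x)))
      + (ψ x * (G x * d2y ψ x) + (if ψ x = 0 then 0 else 1) * (Q x * (G x * Q x)))) Ω :=
    hix.add hiy
  have hi := hform.integrableOn hΩ hb
  refine hlowpos.trans_le ?_
  calc ∫ x in Ω, δ * (ψ x * ψ x)
      ≤ ∫ x in Ω, (ψ x * (-G x * (d2x ψ x + d2y ψ x) + W x * ψ x)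
          + ((ψ x * (G x * d2x ψ x + G' x * P x)
            + (if ψ x = 0 then 0 else 1) * (P x * (G x * P x)))
          + (ψ x * (G x * d2y ψ x) + (if ψ x = 0 then 0 else 1) * (Q x * (G x * Q x))))) := by
        refine setIntegral_mono_on (hlow.integrableOn hΩ hb) (hi.add hixy)
          hΩ.measurableSet fun x hx => ?_
        by_cases h : ψ x = 0
        · simp [h]
        · simp only [if_neg h, one_mul]
          have h1 : -(ψ x ^ 2 / ρ x.1 ^ 2) ≤ ψ x * (G' x * P x) + P x * (G x * P x) :=
            cross_term_bound hr₀ (hrad x hx).1 (ψ x) (P x)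
          have h2 : δ * (ψ x * ψ x) ≤ (W x - 1 / ρ x.1 ^ 2) * (ψ x * ψ x) :=
            mul_le_mul_of_nonneg_right (potential_lower_bound hr₀ (hrad x hx).1 hm β J x.2)
              (mul_self_nonneg (ψ x))
          have h3 : 0 ≤ Q x * (G x * Q x) := by
            have : 0 ≤ G x := div_nonneg (fS_pos hr₀ (hlt x hx)).le (sq_nonneg _)
            nlinarith [mul_nonneg this (mul_self_nonneg (Q x))]
          have h4 : 1 / ρ x.1 ^ 2 * (ψ x * ψ x) = ψ x ^ 2 / ρ x.1 ^ 2 := by ring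
          rw [sub_mul (W x), h4] at h2
          linarith
    _ = ∫ x in Ω, ψ x * (-G x * (d2x ψ x + d2y ψ x) + W x * ψ x) := by
        rw [integral_add hi hixy, integral_add hix hiy, hIx, hIy]
        simp

/-- With `ω = 0`, the quadratic form of the boosted-string operator is
positive on every admissible test function, for `m², J²` large; in particular `ω = 0` is not
a Dirichlet eigenfrequency. -/
theorem statement9 (r₀ β : ℝ) (hr₀ : 0 < r₀) (hβ0 : 0 ≤ β)
    (hβ : Real.cosh β ^ 2 < 3)
    (rs ρ : ℝ → ℝ)
    (hrs_deriv : ∀ r ∈ Set.Ioi r₀, HasDerivAt rs (1 / (r * Real.sqrt (fS r₀ r))) r)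
    (hrs_mono : StrictMonoOn rs (Set.Ioi r₀))
    (hρ : ∀ r ∈ Set.Ioi r₀, ρ (rs r) = r)
    (Ω : Set (ℝ × ℝ)) (hΩopen : IsOpen Ω) (hΩbd : Bornology.IsBounded Ω)
    (hΩsub : Ω ⊆ (rs '' Set.Ioi (3 * r₀)) ×ˢ Set.Ioo 0 Real.pi) :
    ∃ M > (0 : ℝ), ∀ m J : ℤ, M < (m : ℝ) ^ 2 → M < (J : ℝ) ^ 2 →
      (∀ ψ : ℝ × ℝ → ℝ, SmoothNearClosure ψ Ω → (∃ x ∈ Ω, ψ x ≠ 0) →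
        (∀ x ∈ frontier Ω, ψ x = 0) →
        0 < ∫ p in Ω, ψ p *
          (-gS r₀ (ρ p.1) * (d2x ψ p + d2y ψ p)
            + (VjS r₀ (ρ p.1) p.2 + VB r₀ β 0 (m : ℝ) (J : ℝ) (ρ p.1) p.2) * ψ p)) ∧
      ¬ BoostEigFreq r₀ β ρ Ω (m : ℝ) (J : ℝ) 0 := by
  have hc : 0 < 1 - Real.cosh β ^ 2 / 3 := by linarith
  refine ⟨max (1 / 4) (2 / r₀ ^ 2 / (1 - Real.cosh β ^ 2 / 3)), by positivity,
    fun m J hm hJ => ?_⟩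
  have hpos := fun ψ h1 h2 h3 => setIntegral_quadratic_form_pos (β := β) (ψ := ψ) hr₀ hrs_deriv hρ
    hΩopen hΩbd hΩsub ((le_max_left _ _).trans_lt hm)
    ((div_lt_iff₀' hc).1 ((le_max_right _ _).trans_lt hJ)) h1 h2 h3
  refine ⟨hpos, fun ⟨u, hu, hne, hu0, heq⟩ => (hpos u hu hne hu0).ne' ?_⟩
  refine setIntegral_eq_zero_of_forall_eq_zero fun x hx => ?_
  rw [heq x hx]
  ring
end
end

section
/- Let Ω be a bounded open set in the (r*,θ)-plane with r > 3r₀ at every point of Ω, and fix a rational c with 0 < c² < 1/(3r₀²). Then there exist constants C > 0 and M > 0, independent of m, such that for every m ∈ ℤ with m² > M and J = c·m with J > 0, every Dirichlet eigenfrequency ω of the boosted-string problem on Ω with frequencies (m, J) satisfies ω² ≥ C·m². -/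
noncomputable section
open Real Set Filter MeasureTheory

/-- The second derivative is nonpositive at a local maximum. -/
theorem deriv_deriv_nonpos_of_isLocalMax {h : ℝ → ℝ} {x : ℝ} (hmax : IsLocalMax h x)
    (hc : ContinuousAt h x) : deriv (deriv h) x ≤ 0 := by
  by_contra! hpos
  have hmin : IsLocalMin h x := isLocalMin_of_deriv_deriv_pos hpos hmax.deriv_eq_zero hc
  have hconst : h =ᶠ[nhds x] fun _ => h x := by
    filter_upwards [hmax, hmin] with y h₁ h₂ using le_antisymm h₁ h₂
  have hzero : deriv (deriv h) x = 0 := by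
    rw [hconst.deriv.deriv_eq]
    simp
  exact hpos.ne' hzero

/-- The coordinate Laplacian is nonpositive at a local maximum. -/
theorem d2x_add_d2y_nonpos_of_isLocalMax {u : ℝ × ℝ → ℝ} {p : ℝ × ℝ} (hmax : IsLocalMax u p)
    (hc : ContinuousAt u p) : d2x u p + d2y u p ≤ 0 := by
  have hx : ContinuousAt (fun s : ℝ => (s, p.2)) p.1 := by fun_prop
  have hy : ContinuousAt (fun s : ℝ => (p.1, s)) p.2 := by fun_prop
  refine add_nonpos (deriv_deriv_nonpos_of_isLocalMax (hx.eventually hmax) ?_)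
    (deriv_deriv_nonpos_of_isLocalMax (hy.eventually hmax) ?_)
  · exact ContinuousAt.comp (g := u) hc hx
  · exact ContinuousAt.comp (g := u) hc hy

theorem d2x_neg (u : ℝ × ℝ → ℝ) (p : ℝ × ℝ) : d2x (fun q => -u q) p = -d2x u p := by
  simp [d2x]

theorem d2y_neg (u : ℝ × ℝ → ℝ) (p : ℝ × ℝ) : d2y (fun q => -u q) p = -d2y u p := by
  simp [d2y]

/-- A continuous function on the closure of a bounded open set which vanishes on the boundary and
is positive somewhere has a positive interior maximum. -/
theorem exists_pos_isLocalMax {u : ℝ × ℝ → ℝ} {Ω : Set (ℝ × ℝ)} (hΩ : IsOpen Ω)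
    (hb : Bornology.IsBounded Ω) (hu : ContinuousOn u (closure Ω))
    (h0 : ∀ x ∈ frontier Ω, u x = 0) (hpos : ∃ x ∈ Ω, 0 < u x) :
    ∃ p ∈ Ω, 0 < u p ∧ IsLocalMax u p := by
  obtain ⟨x, hx, hux⟩ := hpos
  obtain ⟨p, hp, hmax⟩ := hb.isCompact_closure.exists_isMaxOn ⟨x, subset_closure hx⟩ hu
  have hup : 0 < u p := hux.trans_le (hmax (subset_closure hx))
  have hpΩ : p ∈ Ω := by
    by_contra hn
    exact hup.ne' (h0 p (by rw [hΩ.frontier_eq]; exact ⟨hp, hn⟩))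
  exact ⟨p, hpΩ, hup, hmax.isLocalMax (mem_of_superset (hΩ.mem_nhds hpΩ) subset_closure)⟩

/-- A nonzero Dirichlet solution of `-G Δu + W u = E u` with `G ≥ 0` forces `W ≤ E` at some
point. -/
theorem exists_potential_le_of_dirichlet {u G W : ℝ × ℝ → ℝ} {E : ℝ} {Ω : Set (ℝ × ℝ)}
    (hΩ : IsOpen Ω) (hb : Bornology.IsBounded Ω) (hG : ∀ p ∈ Ω, 0 ≤ G p)
    (hu : ContinuousOn u (closure Ω)) (h0 : ∀ x ∈ frontier Ω, u x = 0)
    (hne : ∃ x ∈ Ω, u x ≠ 0)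
    (heq : ∀ p ∈ Ω, -G p * (d2x u p + d2y u p) + W p * u p = E * u p) :
    ∃ p ∈ Ω, W p ≤ E := by
  wlog hpos : ∃ x ∈ Ω, 0 < u x generalizing u
  · obtain ⟨x, hx, hux⟩ := hne
    have hux' : u x < 0 := lt_of_le_of_ne (not_lt.mp fun h => hpos ⟨x, hx, h⟩) hux
    refine this (u := fun q => -u q) hu.neg (fun y hy => by simp [h0 y hy])
      ⟨x, hx, by simpa using hux⟩ (fun p hp => ?_) ⟨x, hx, by simpa using hux'⟩
    rw [d2x_neg, d2y_neg]
    linear_combination -heq p hp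
  obtain ⟨p, hp, hup, hmax⟩ := exists_pos_isLocalMax hΩ hb hu h0 hpos
  have hlap := d2x_add_d2y_nonpos_of_isLocalMax hmax
    (hu.continuousAt (mem_of_superset (hΩ.mem_nhds hp) subset_closure))
  refine ⟨p, hp, le_of_mul_le_mul_right ?_ hup⟩
  nlinarith [heq p hp, mul_nonpos_of_nonneg_of_nonpos (hG p hp) hlap]

/-- Lower bound for the full potential on `r > 3r₀`, with the mixed `ωJ` term absorbed. -/
theorem le_VjS_add_VB {r₀ β ω m J r θ : ℝ} (hr₀ : 0 < r₀) (hβ : Real.cosh β ^ 2 < 3)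
    (hr : 3 * r₀ < r) (hm : 1 ≤ m ^ 2) :
    3 / 4 * (1 - Real.cosh β ^ 2 / 3) * J ^ 2 - 1 / r₀ ^ 2
        - (Real.sinh β ^ 2
          + 4 * (Real.sinh β * Real.cosh β) ^ 2 / (1 - Real.cosh β ^ 2 / 3)) * ω ^ 2
      ≤ VjS r₀ r θ + VB r₀ β ω m J r θ := by
  have hrpos : 0 < r := by linarith
  set S := Real.sinh β
  set K := Real.cosh β
  set δ := 1 - K ^ 2 / 3 with hδ
  have hδ0 : 0 < δ := by rw [hδ]; linarith
  have hf : 0 < fS r₀ r := fS_pos hr₀ (by linarith)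
  have hx : 1 - fS r₀ r = r₀ / r := by rw [fS]; ring
  set x := r₀ / r with hxdef
  have hx0 : 0 < x := div_pos hr₀ hrpos
  have hx3 : x ≤ 1 / 3 := by
    rw [hxdef, div_le_div_iff₀ hrpos (by norm_num)]
    linarith
  have hVj : VjS r₀ r θ
      = -(fS r₀ r / (r ^ 2 * Real.sin θ ^ 2)) / 4 - r₀ ^ 2 / (16 * r ^ 4) := by
    rw [VjS, fS]
    by_cases hs : Real.sin θ = 0
    · simp [hs]
    · field_simp
  have hA : 0 ≤ fS r₀ r / (r ^ 2 * Real.sin θ ^ 2) := by positivity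
  have hR : r₀ ^ 2 / (16 * r ^ 4) ≤ 1 / r₀ ^ 2 := by
    rw [div_le_div_iff₀ (by positivity) (by positivity)]
    have : r₀ ^ 4 ≤ r ^ 4 := by gcongr; linarith
    nlinarith [pow_pos hrpos 4]
  have hωS : x * S ^ 2 * ω ^ 2 ≤ S ^ 2 * ω ^ 2 := by
    nlinarith [mul_nonneg (sq_nonneg S) (sq_nonneg ω)]
  have hJ : δ * J ^ 2 ≤ (1 - x * K ^ 2) * J ^ 2 := by
    refine mul_le_mul_of_nonneg_right ?_ (sq_nonneg J)
    rw [hδ]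
    nlinarith [sq_nonneg K]
  have hyoung : 2 * x * S * K * ω * J ≤ 4 * (S * K) ^ 2 / δ * ω ^ 2 + δ / 4 * J ^ 2 := by
    have h₁ : 2 * x * S * K * ω * J
        ≤ 4 * x ^ 2 * (S * K) ^ 2 / δ * ω ^ 2 + δ / 4 * J ^ 2 := by
      have hsq : 4 * x ^ 2 * (S * K) ^ 2 / δ * ω ^ 2 + δ / 4 * J ^ 2 - 2 * x * S * K * ω * J
          = (4 * x * (S * K) * ω - δ * J) ^ 2 / (4 * δ) := by
        field_simp
        ring
      have : 0 ≤ (4 * x * (S * K) * ω - δ * J) ^ 2 / (4 * δ) := by positivity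
      linarith
    have h₂ : 4 * x ^ 2 * (S * K) ^ 2 / δ * ω ^ 2 ≤ 4 * (S * K) ^ 2 / δ * ω ^ 2 := by
      gcongr
      nlinarith [sq_nonneg (S * K)]
    linarith
  rw [hVj, VB, hx]
  nlinarith [mul_nonneg hA (sub_nonneg.mpr hm)]

/-- Any Dirichlet eigenfrequency of the boosted-string problem on `Ω`
with `J = c·m > 0` satisfies `ω² ≥ C·m²` for `m²` large, with `C` independent of `m`. -/
theorem statement10 (r₀ β : ℝ) (hr₀ : 0 < r₀) (hβ0 : 0 ≤ β)
    (hβ : Real.cosh β ^ 2 < 3)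
    (rs ρ : ℝ → ℝ)
    (hrs_deriv : ∀ r ∈ Set.Ioi r₀, HasDerivAt rs (1 / (r * Real.sqrt (fS r₀ r))) r)
    (hrs_mono : StrictMonoOn rs (Set.Ioi r₀))
    (hρ : ∀ r ∈ Set.Ioi r₀, ρ (rs r) = r)
    (Ω : Set (ℝ × ℝ)) (hΩopen : IsOpen Ω) (hΩbd : Bornology.IsBounded Ω)
    (hΩsub : Ω ⊆ (rs '' Set.Ioi (3 * r₀)) ×ˢ Set.Ioo 0 Real.pi)
    (c : ℚ) (hc0 : 0 < (c : ℝ) ^ 2) (hc : (c : ℝ) ^ 2 < 1 / (3 * r₀ ^ 2)) :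
    ∃ C > (0 : ℝ), ∃ M > (0 : ℝ), ∀ m J : ℤ, M < (m : ℝ) ^ 2 →
      (J : ℝ) = (c : ℝ) * (m : ℝ) → 0 < J →
      ∀ ω : ℝ, BoostEigFreq r₀ β ρ Ω (m : ℝ) (J : ℝ) ω →
        C * (m : ℝ) ^ 2 ≤ ω ^ 2 := by
  have hδ : 0 < 1 - Real.cosh β ^ 2 / 3 := by linarith
  set δ := 1 - Real.cosh β ^ 2 / 3
  set B := Real.sinh β ^ 2 + 4 * (Real.sinh β * Real.cosh β) ^ 2 / δ
  have hB : 0 ≤ B := by positivity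
  refine ⟨δ / 2 * (c : ℝ) ^ 2 / (1 + B), by positivity, 1 + 4 / (δ * (c : ℝ) ^ 2 * r₀ ^ 2),
    by positivity, fun m J hm hJ _ ω hω => ?_⟩
  obtain ⟨u, ⟨U, -, hU, hu⟩, hne, h0, heq⟩ := hω
  have hρΩ : ∀ p ∈ Ω, 3 * r₀ < ρ p.1 := by
    intro p hp
    obtain ⟨r, hr, hrp⟩ := (hΩsub hp).1
    rw [mem_Ioi] at hr
    rw [← hrp, hρ r (by rw [mem_Ioi]; linarith)]
    exact hr
  obtain ⟨p, hp, hW⟩ := exists_potential_le_of_dirichlet (G := fun p => gS r₀ (ρ p.1))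
    (W := fun p => VjS r₀ (ρ p.1) p.2 + VB r₀ β ω m J (ρ p.1) p.2) hΩopen hΩbd
    (fun p hp => div_nonneg (fS_pos hr₀ (by linarith [hρΩ p hp])).le (sq_nonneg _))
    (hu.continuousOn.mono hU) h0 hne heq
  have hm1 : 1 ≤ (m : ℝ) ^ 2 := by
    have : 0 ≤ 4 / (δ * (c : ℝ) ^ 2 * r₀ ^ 2) := by positivity
    linarith
  have hbound := (le_VjS_add_VB (ω := ω) (J := J) (θ := p.2) hr₀ hβ (hρΩ p hp) hm1).trans hW
  change 3 / 4 * δ * (J : ℝ) ^ 2 - 1 / r₀ ^ 2 - B * ω ^ 2 ≤ ω ^ 2 at hbound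
  have hlarge : 1 / r₀ ^ 2 ≤ δ / 4 * (J : ℝ) ^ 2 := by
    have h : 4 / (δ * (c : ℝ) ^ 2 * r₀ ^ 2) ≤ (m : ℝ) ^ 2 := by linarith
    rw [div_le_iff₀ (by positivity)] at h
    rw [div_le_iff₀ (by positivity), hJ]
    linarith
  have hfinal : δ / 2 * (J : ℝ) ^ 2 ≤ (1 + B) * ω ^ 2 := by linarith
  rw [div_mul_eq_mul_div, div_le_iff₀ (by positivity)]
  rw [hJ] at hfinal
  linarith
end
end

section
/- There exist constants C > 0 and M > 0, independent of m, such that for every m ∈ ℤ with m² > M, every ring Dirichlet eigenfrequency ω on Ω with frequencies (m, Ĵ = R·c·m) satisfies ω² ≥ C·m². -/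
noncomputable section
open Real Set Filter MeasureTheory

/-- The boost parameter `β = β_R`, defined by `cosh²β = 2R²/(4 + R²)`, `β ≥ 0`. -/
def βRing (R : ℝ) : ℝ := Real.arsinh (Real.sqrt ((R ^ 2 - 4) / (4 + R ^ 2)))

/-- The limiting boost parameter `β₀`, with `cosh β₀ = √2`. -/
def β₀ : ℝ := Real.arsinh 1

/-- `f₁(r,θ)`. -/
def f₁ (R r θ : ℝ) : ℝ :=
  (r - 2) * (R + r * Real.cos θ) ^ 2 /
    (R * r ^ 3 * (2 * Real.cos θ + R) * Real.sin θ ^ 2)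

/-- `f₂(r,θ)`. -/
def f₂ (R r θ : ℝ) : ℝ :=
  4 * (R - r) * (R + r * Real.cos θ) ^ 2 *
      (R * Real.sinh (2 * βRing R) ^ 2
        + 8 * Real.cosh (βRing R) ^ 4 * Real.sinh (βRing R) ^ 2) /
    (4 * r * R * (r + R) * (R - 2 * Real.cosh (βRing R) ^ 2) *
      (r - 2 * Real.cosh (βRing R) ^ 2) *
      (R + 2 * Real.cosh (βRing R) ^ 2 * Real.cos θ))
  - (r - 2) * (R + 2 * Real.cosh (βRing R) ^ 2 * Real.cos θ) /
      (R * (r - 2 * Real.cosh (βRing R) ^ 2))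

/-- `f₃(r,θ)`. -/
def f₃ (R r θ : ℝ) : ℝ :=
  (4 * Real.sinh (βRing R) * Real.cosh (βRing R) * (R + r * Real.cos θ) ^ 2 /
      (r * R * (R + r) * (2 * Real.cosh (βRing R) ^ 2 * Real.cos θ + R))) *
    Real.sqrt ((R + 2 * Real.cosh (βRing R) ^ 2) / (R - 2 * Real.cosh (βRing R) ^ 2))

/-- `f₄(r,θ)`. -/
def f₄ (R r θ : ℝ) : ℝ :=
  (r - 2 * Real.cosh (βRing R) ^ 2) * (R + r * Real.cos θ) ^ 2 /
    (r * R * (R ^ 2 - r ^ 2) * (2 * Real.cosh (βRing R) ^ 2 * Real.cos θ + R))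

/-- The black ring potential `V^ring_{(ω,m,Jh)} = f₁m² + f₂ω² + f₃ωJh + f₄Jh²`. -/
def Vring (R ω m Jh r θ : ℝ) : ℝ :=
  f₁ R r θ * m ^ 2 + f₂ R r θ * ω ^ 2 + f₃ R r θ * (ω * Jh) + f₄ R r θ * Jh ^ 2

/-- The boosted black string potential (with `r₀ = 2` and boost `β₀`):
`V̂^{β₀}_{(ω,m,J)}(r,θ)`. -/
def VhatB0 (ω m J r θ : ℝ) : ℝ :=
  ((1 - 2 / r) / (r ^ 2 * Real.sin θ ^ 2)) * m ^ 2
    - (2 / r) * (ω * Real.sinh β₀ + J * Real.cosh β₀) ^ 2 + J ^ 2 - ω ^ 2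

/-- The rescaled ring potential `m⁻²·V^ring_{(κm, m, Rcm)} = f₁ + f₂κ² + f₃κRc + f₄R²c²`,
independent of `m`. -/
def WRing (R c κ : ℝ) (p : ℝ × ℝ) : ℝ :=
  f₁ R p.1 p.2 + f₂ R p.1 p.2 * κ ^ 2 + f₃ R p.1 p.2 * (κ * (R * c))
    + f₄ R p.1 p.2 * (R * c) ^ 2

/-- The rescaled boosted black string potential (`r₀ = 2`, boost `b`):
`m⁻²·V̂^b_{(κm, m, cm)}`. -/
def WStr (b c κ : ℝ) (p : ℝ × ℝ) : ℝ :=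
  (1 - 2 / p.1) / (p.1 ^ 2 * Real.sin p.2 ^ 2)
    - (2 / p.1) * (κ * Real.sinh b + c * Real.cosh b) ^ 2 + c ^ 2 - κ ^ 2

/-- Configuration for a potential `W` on a bounded set `Ω ⊆ (2,R)×(0,π)`: `Ω` contains a
local minimum point of `W`, `W = 0` on `∂Ω`, no local maxima of `W` in `Ω`, and `r > 6`
at every point of `Ω`. -/
def RingGoodSet (R : ℝ) (W : ℝ × ℝ → ℝ) (Ω : Set (ℝ × ℝ)) : Prop :=
  Bornology.IsBounded Ω ∧ Ω ⊆ Set.Ioo 2 R ×ˢ Set.Ioo 0 Real.pi ∧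
    (∃ x ∈ Ω, IsLocalMin W x) ∧ (∀ y ∈ frontier Ω, W y = 0) ∧
    (∀ y ∈ Ω, ¬ IsLocalMax W y) ∧ (∀ y ∈ Ω, 6 < y.1)

/-- The auxiliary inequalities required on `Ω`. -/
def RingIneqs (R : ℝ) (Ω : Set (ℝ × ℝ)) : Prop :=
  ∀ y ∈ Ω,
    16 / (y.1 * (4 + R ^ 2)) < |(-1 : ℝ) - (2 / y.1) * Real.sinh β₀ ^ 2| ∧
    16 / (y.1 * (4 + R ^ 2)) < |1 - (2 / y.1) * Real.cosh β₀ ^ 2| ∧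
    (4 * Real.sqrt 2 / y.1) * (1 - Real.sqrt (R ^ 2 * (R ^ 2 - 4)) / (4 + R ^ 2))
      < (4 / y.1) * Real.sinh β₀ * Real.cosh β₀

/-- The black ring metric `g_{(2,R)}` in coordinates `x = (t, r, θ, φ, ψ)`
(indices `0,…,4`), as a `5×5` matrix of components. -/
def ringMetric (R : ℝ) (x : Fin 5 → ℝ) : Matrix (Fin 5) (Fin 5) ℝ :=
  let r := x 1
  let θ := x 2
  let ch := 2 * Real.cosh (βRing R) ^ 2          -- 2cosh²β
  let f := 1 - 2 / r
  let fh := 1 - ch / r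
  let g1 := 1 + (2 / R) * Real.cos θ
  let gh := 1 + (ch / R) * Real.cos θ
  let hh := 1 + r * Real.cos θ / R
  let K := 2 * Real.sinh (βRing R) * Real.cosh (βRing R) *
      Real.sqrt ((R + ch) / (R - ch)) * ((r / R - 1) / (r * fh)) * R
  !![-(fh / gh),      0,                                   0,                      0,                                          (fh / gh) * K;
     0,               (gh / hh ^ 2) / ((1 - r ^ 2 / R ^ 2) * f), 0,               0,                                          0;
     0,               0,                                   (gh / hh ^ 2) * (r ^ 2 / g1), 0,                                   0;
     0,               0,                                   0,                      (gh / hh ^ 2) * (g1 / gh) * r ^ 2 * Real.sin θ ^ 2, 0;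
     (fh / gh) * K,   0,                                   0,                      0,                                          -(fh / gh) * K ^ 2 + (gh / hh ^ 2) * ((f / fh) * (1 - r ^ 2 / R ^ 2) * R ^ 2)]

/-- Partial derivative of a function of the five coordinates along the `μ`-th coordinate. -/
def pd (μ : Fin 5) (F : (Fin 5 → ℝ) → ℂ) (x : Fin 5 → ℝ) : ℂ :=
  deriv (fun s => F (Function.update x μ s)) (x μ)

/-- The wave operator `□_g Ψ = (−det g)^{−1/2} ∂_μ((−det g)^{1/2} g^{μν} ∂_ν Ψ)` for the
black ring metric. -/
def boxRing (R : ℝ) (Ψ : (Fin 5 → ℝ) → ℂ) (x : Fin 5 → ℝ) : ℂ :=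
  (Complex.ofReal (Real.sqrt (-(ringMetric R x).det)))⁻¹ *
    ∑ μ : Fin 5, pd μ (fun y =>
      ∑ ν : Fin 5,
        Complex.ofReal (Real.sqrt (-(ringMetric R y).det) * (ringMetric R y)⁻¹ μ ν) *
          pd ν Ψ y) x

/-- `ω` is a ring Dirichlet eigenfrequency on `Ω` with frequencies `(m, Ĵ)`, with
associated eigenfunction `u`: `u` is smooth on a neighbourhood of the closure of `Ω`, not
identically zero, vanishes on `∂Ω`, and `Ψ = e^{i(−ωt + mφ + Ĵψ)}u(r,θ)` solves
`□_{g_{(2,R)}}Ψ = 0` at every point with `(r,θ) ∈ Ω`. -/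
def RingEigWith (R : ℝ) (Ω : Set (ℝ × ℝ)) (m Jh ω : ℝ) (u : ℝ × ℝ → ℂ) : Prop :=
  (∃ U : Set (ℝ × ℝ), IsOpen U ∧ closure Ω ⊆ U ∧ ContDiffOn ℝ (⊤ : ℕ∞) u U) ∧
  (∃ p ∈ Ω, u p ≠ 0) ∧ (∀ p ∈ frontier Ω, u p = 0) ∧
  ∀ x : Fin 5 → ℝ, (x 1, x 2) ∈ Ω →
    boxRing R
      (fun y => Complex.exp (Complex.I *
          Complex.ofReal (-ω * y 0 + m * y 3 + Jh * y 4)) * u (y 1, y 2)) x = 0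

/-- `ω` is a ring Dirichlet eigenfrequency on `Ω` with frequencies `(m, Ĵ)`. -/
def RingEig (R : ℝ) (Ω : Set (ℝ × ℝ)) (m Jh ω : ℝ) : Prop :=
  ∃ u : ℝ × ℝ → ℂ, RingEigWith R Ω m Jh ω u

/-- A metric block of Kaluza–Klein form together with a diagonal part. -/
def blockMetric (a K b A B D : ℝ) : Matrix (Fin 5) (Fin 5) ℝ :=
  !![-a, 0, 0, 0, a * K;
     0, A, 0, 0, 0;
     0, 0, B, 0, 0;
     0, 0, 0, D, 0;
     a * K, 0, 0, 0, -a * K ^ 2 + b]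

lemma blockMetric_inv {a K b A B D : ℝ} (ha : a ≠ 0) (hb : b ≠ 0) (hA : A ≠ 0) (hB : B ≠ 0)
    (hD : D ≠ 0) :
    (blockMetric a K b A B D)⁻¹ =
      !![-a⁻¹ + K ^ 2 / b, 0, 0, 0, K / b;
         0, A⁻¹, 0, 0, 0;
         0, 0, B⁻¹, 0, 0;
         0, 0, 0, D⁻¹, 0;
         K / b, 0, 0, 0, b⁻¹] := by
  apply Matrix.inv_eq_right_inv
  ext i j
  fin_cases i <;> fin_cases j <;>
    simp [blockMetric, Matrix.mul_apply, Fin.sum_univ_five, hA, hB, hD] <;>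
    field_simp <;> ring

lemma blockMetric_det (a K b A B D : ℝ) :
    (blockMetric a K b A B D).det = -(a * b * A * B * D) := by
  simp [blockMetric, Matrix.det_succ_row_zero, Fin.sum_univ_succ, Fin.succAbove]
  ring

lemma two_mul_cosh_βRing_sq_lt (R : ℝ) : 2 * Real.cosh (βRing R) ^ 2 < 4 := by
  have h1 : Real.sqrt ((R ^ 2 - 4) / (4 + R ^ 2)) ^ 2 < 1 := by
    rcases le_total 0 ((R ^ 2 - 4) / (4 + R ^ 2)) with h | h
    · rw [Real.sq_sqrt h, div_lt_one (by positivity)]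
      linarith
    · simp [Real.sqrt_eq_zero_of_nonpos h]
  rw [Real.cosh_sq, βRing, Real.sinh_arsinh]
  linarith

lemma two_mul_cosh_βRing_sq_pos (R : ℝ) : 0 < 2 * Real.cosh (βRing R) ^ 2 := by
  have := Real.cosh_pos (βRing R)
  positivity

lemma one_add_div_mul_cos_mem {R k : ℝ} (hR : 6 < R) (hk0 : 0 ≤ k) (hk : k ≤ 4) (θ : ℝ) :
    0 < 1 + k / R * Real.cos θ ∧ 1 + k / R * Real.cos θ ≤ 2 := by
  have h0 : 0 ≤ k / R := by positivity
  have h1 : k / R < 1 := by rw [div_lt_one (by linarith)]; linarith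
  have := Real.neg_one_le_cos θ
  have := Real.cos_le_one θ
  constructor <;> nlinarith

lemma one_add_mul_cos_div_pos {R r : ℝ} (hr : 0 < r) (hrR : r < R) (θ : ℝ) :
    0 < 1 + r * Real.cos θ / R := by
  have hR : 0 < R := hr.trans hrR
  have h : -1 < r * Real.cos θ / R := by
    rw [lt_div_iff₀ hR]
    nlinarith [Real.neg_one_le_cos θ]
  linarith

/-- For `6 < r < R` and `0 < θ < π` the ring metric is a block metric with positive
parameters, with lower bound on the time block and upper bound on the `φφ` component. -/
lemma ringMetric_eq_blockMetric {R : ℝ} {x : Fin 5 → ℝ} (hr : 6 < x 1) (hrR : x 1 < R)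
    (hθ0 : 0 < x 2) (hθ : x 2 < Real.pi) :
    ∃ a K b A B D : ℝ, 1 / 6 ≤ a ∧ 0 < b ∧ 0 < A ∧ 0 < B ∧ 0 < D ∧
      D * (1 + x 1 * Real.cos (x 2) / R) ^ 2 ≤ 2 * R ^ 2 ∧
      ringMetric R x = blockMetric a K b A B D := by
  have hk0 := two_mul_cosh_βRing_sq_pos R
  have hk4 := two_mul_cosh_βRing_sq_lt R
  have hR : 6 < R := hr.trans hrR
  obtain ⟨hg1, hg1'⟩ := one_add_div_mul_cos_mem hR (k := 2) (by norm_num) (by norm_num) (x 2)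
  obtain ⟨hgh, hgh'⟩ := one_add_div_mul_cos_mem hR hk0.le hk4.le (x 2)
  have hh := one_add_mul_cos_div_pos (by linarith) hrR (x 2)
  have hsin := Real.sin_pos_of_pos_of_lt_pi hθ0 hθ
  have hfh : 1 / 3 < 1 - 2 * Real.cosh (βRing R) ^ 2 / x 1 := by
    have : 2 * Real.cosh (βRing R) ^ 2 / x 1 < 2 / 3 := by
      rw [div_lt_iff₀ (by linarith)]; linarith
    linarith
  have hf : 0 < 1 - 2 / x 1 := by
    have : 2 / x 1 < 1 := by rw [div_lt_one (by linarith)]; linarith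
    linarith
  have hq : 0 < 1 - x 1 ^ 2 / R ^ 2 := by
    have : x 1 ^ 2 / R ^ 2 < 1 := by
      rw [div_lt_one (by positivity)]; nlinarith
    linarith
  have hr0 : 0 < x 1 := by linarith
  have hR0 : 0 < R := by linarith
  refine ⟨_, _, _, _, _, _, ?_, ?_, ?_, ?_, ?_, ?_, rfl⟩
  · rw [le_div_iff₀ hgh]; linarith
  · have : 0 < 1 - 2 * Real.cosh (βRing R) ^ 2 / x 1 := by linarith
    positivity
  · positivity
  · positivity
  · positivity
  · have hs1 : Real.sin (x 2) ^ 2 ≤ 1 := Real.sin_sq_le_one _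
    have hrr : x 1 ^ 2 ≤ R ^ 2 := by nlinarith
    have key : (1 + 2 / R * Real.cos (x 2)) * x 1 ^ 2 * Real.sin (x 2) ^ 2 ≤ 2 * R ^ 2 * 1 := by
      gcongr
    refine le_trans (le_of_eq ?_) (key.trans_eq (mul_one _))
    generalize 1 + 2 * Real.cosh (βRing R) ^ 2 / R * Real.cos (x 2) = gh at *
    generalize 1 + x 1 * Real.cos (x 2) / R = h at *
    field_simp

lemma deriv_nonpos_of_isLocalMax {v k G : ℝ → ℝ} {a : ℝ} (hmax : IsLocalMax v a)
    (hv : ∀ᶠ s in nhds a, DifferentiableAt ℝ v s) (hk : ∀ᶠ s in nhds a, 0 < k s)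
    (hG : ∀ᶠ s in nhds a, G s = k s * deriv v s) : deriv G a ≤ 0 := by
  by_contra! hpos
  have hG0 : G a = 0 := by rw [hG.self_of_nhds, hmax.deriv_eq_zero, mul_zero]
  have hGpos : ∀ᶠ s in nhdsWithin a (Set.Ioi a), 0 < G s := by
    have hd : HasDerivAt G (deriv G a) a :=
      (differentiableAt_of_deriv_ne_zero hpos.ne').hasDerivAt
    have := (hasDerivAt_iff_tendsto_slope.1 hd).eventually (lt_mem_nhds hpos)
    filter_upwards [this.filter_mono (nhdsWithin_mono a fun s hs => ne_of_gt hs),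
      self_mem_nhdsWithin] with s hs hsa
    rw [slope_def_field, hG0, sub_zero] at hs
    have hsa' : 0 < s - a := sub_pos.2 hsa
    exact (div_pos_iff_of_pos_right hsa').1 hs
  have hall := hGpos.and (((hmax.and hv).and (hk.and hG)).filter_mono nhdsWithin_le_nhds)
  obtain ⟨b, hab, hb⟩ := mem_nhdsGT_iff_exists_Ioo_subset.1 hall
  have hab : a < b := hab
  obtain ⟨c, hac, hcb⟩ := exists_between hab
  have hcont : ContinuousOn v (Set.Icc a c) := by
    intro s hs
    rcases hs.1.eq_or_lt with rfl | h
    · exact hv.self_of_nhds.continuousAt.continuousWithinAt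
    · exact (hb ⟨h, hs.2.trans_lt hcb⟩).2.1.2.continuousAt.continuousWithinAt
  have hmono : StrictMonoOn v (Set.Icc a c) := by
    refine strictMonoOn_of_deriv_pos (convex_Icc a c) hcont fun s hs => ?_
    rw [interior_Icc] at hs
    obtain ⟨h1, -, h2, h3⟩ := hb ⟨hs.1, hs.2.trans hcb⟩
    rw [h3] at h1
    exact (pos_iff_pos_of_mul_pos h1).1 h2
  have h1 := hmono (Set.left_mem_Icc.2 hac.le) (Set.right_mem_Icc.2 hac.le) hac
  exact (hb ⟨hac, hcb⟩).2.1.1.not_gt h1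

/-- At a local maximum of `‖u‖`, a one-dimensional divergence-form operator applied to `u`
points against `u`. -/
lemma re_conj_mul_deriv_nonpos {u G : ℝ → ℂ} {k : ℝ → ℝ} {a : ℝ}
    (hmax : ∀ᶠ s in nhds a, ‖u s‖ ≤ ‖u a‖)
    (hu : ∀ᶠ s in nhds a, DifferentiableAt ℝ u s) (hk : ∀ᶠ s in nhds a, 0 < k s)
    (hG : ∀ᶠ s in nhds a, G s = (k s : ℂ) * deriv u s) :
    (star (u a) * deriv G a).re ≤ 0 := by
  by_cases hd : DifferentiableAt ℝ G a
  swap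
  · simp [deriv_zero_of_not_differentiableAt hd]
  have hre : ∀ {w : ℝ → ℂ} {w' : ℂ} {s : ℝ}, HasDerivAt w w' s →
      HasDerivAt (fun t => (star (u a) * w t).re) (star (u a) * w').re s := fun h =>
    Complex.reCLM.hasFDerivAt.comp_hasDerivAt _ (h.const_mul (star (u a)))
  rw [← (hre hd.hasDerivAt).deriv]
  refine deriv_nonpos_of_isLocalMax (v := fun t => (star (u a) * u t).re) (k := k) ?_ ?_ hk ?_
  · filter_upwards [hmax] with s hs
    calc (star (u a) * u s).re ≤ ‖star (u a) * u s‖ := Complex.re_le_norm _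
      _ = ‖u a‖ * ‖u s‖ := by rw [norm_mul, norm_star]
      _ ≤ ‖u a‖ * ‖u a‖ := by gcongr
      _ = (star (u a) * u a).re := by
        rw [Complex.star_def, ← Complex.normSq_eq_conj_mul_self, Complex.ofReal_re,
          Complex.normSq_eq_norm_sq, sq]
  · filter_upwards [hu] with s hs using (hre hs.hasDerivAt).differentiableAt
  · filter_upwards [hu, hG] with s hs hGs
    rw [(hre hs.hasDerivAt).deriv, hGs, mul_left_comm, Complex.re_ofReal_mul]

/-- The point with `t = φ = ψ = 0` and prescribed `(r, θ)`. -/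
def slicePoint (r θ : ℝ) : Fin 5 → ℝ := ![0, r, θ, 0, 0]

/-- The separated wave `e^{i(−ωt + mφ + Jψ)} u(r,θ)`. -/
def separatedWave (ω m J : ℝ) (u : ℝ × ℝ → ℂ) (y : Fin 5 → ℝ) : ℂ :=
  Complex.exp (Complex.I * Complex.ofReal (-ω * y 0 + m * y 3 + J * y 4)) * u (y 1, y 2)

lemma ringMetric_congr {R : ℝ} {x y : Fin 5 → ℝ} (h1 : x 1 = y 1) (h2 : x 2 = y 2) :
    ringMetric R x = ringMetric R y := by
  simp only [ringMetric, h1, h2]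

lemma deriv_exp_affine_mul (α β : ℝ) (w : ℂ) (s : ℝ) :
    deriv (fun s : ℝ => Complex.exp (Complex.I * Complex.ofReal (α * s + β)) * w) s =
      Complex.I * α * (Complex.exp (Complex.I * Complex.ofReal (α * s + β)) * w) := by
  have h : HasDerivAt (fun s : ℝ => Complex.I * Complex.ofReal (α * s + β))
      (Complex.I * α) s := by
    have h1 : HasDerivAt (fun s : ℝ => α * s + β) α s := by
      simpa using ((hasDerivAt_id s).const_mul α).add_const β
    exact h1.ofReal_comp.const_mul _
  rw [(h.cexp.mul_const w).deriv]
  ring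

section Wave

variable (ω m J : ℝ) (u : ℝ × ℝ → ℂ)

lemma separatedWave_update_zero (y : Fin 5 → ℝ) (s : ℝ) :
    separatedWave ω m J u (Function.update y 0 s) =
      Complex.exp (Complex.I * Complex.ofReal (-ω * s + (m * y 3 + J * y 4))) * u (y 1, y 2) := by
  simp [separatedWave, Function.update, add_assoc]

lemma separatedWave_update_three (y : Fin 5 → ℝ) (s : ℝ) :
    separatedWave ω m J u (Function.update y 3 s) =
      Complex.exp (Complex.I * Complex.ofReal (m * s + (-ω * y 0 + J * y 4))) * u (y 1, y 2) := by
  simp only [separatedWave, Function.update]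
  simp
  left; ring_nf

lemma separatedWave_update_four (y : Fin 5 → ℝ) (s : ℝ) :
    separatedWave ω m J u (Function.update y 4 s) =
      Complex.exp (Complex.I * Complex.ofReal (J * s + (-ω * y 0 + m * y 3))) * u (y 1, y 2) := by
  simp only [separatedWave, Function.update]
  simp
  left; ring_nf

lemma pd_zero_separatedWave (y : Fin 5 → ℝ) :
    pd 0 (separatedWave ω m J u) y = Complex.I * (-ω : ℝ) * separatedWave ω m J u y := by
  have h := separatedWave_update_zero ω m J u y (y 0)
  rw [Function.update_eq_self] at h
  simp only [pd, separatedWave_update_zero]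
  rw [deriv_exp_affine_mul, h]

lemma pd_three_separatedWave (y : Fin 5 → ℝ) :
    pd 3 (separatedWave ω m J u) y = Complex.I * m * separatedWave ω m J u y := by
  have h := separatedWave_update_three ω m J u y (y 3)
  rw [Function.update_eq_self] at h
  simp only [pd, separatedWave_update_three]
  rw [deriv_exp_affine_mul, h]

lemma pd_four_separatedWave (y : Fin 5 → ℝ) :
    pd 4 (separatedWave ω m J u) y = Complex.I * J * separatedWave ω m J u y := by
  have h := separatedWave_update_four ω m J u y (y 4)
  rw [Function.update_eq_self] at h
  simp only [pd, separatedWave_update_four]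
  rw [deriv_exp_affine_mul, h]

lemma pd_one_separatedWave_slicePoint (r θ : ℝ) :
    pd 1 (separatedWave ω m J u) (slicePoint r θ) = deriv (fun s => u (s, θ)) r := by
  simp [pd, separatedWave, slicePoint, Function.update]

lemma pd_two_separatedWave_slicePoint (r θ : ℝ) :
    pd 2 (separatedWave ω m J u) (slicePoint r θ) = deriv (fun s => u (r, s)) θ := by
  simp [pd, separatedWave, slicePoint, Function.update]

lemma pd_mul_congr {μ : Fin 5} {F P : (Fin 5 → ℝ) → ℂ} {x : Fin 5 → ℝ} {k : ℂ}
    (h : ∀ s, F (Function.update x μ s) = k * P (Function.update x μ s)) :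
    pd μ F x = k * pd μ P x := by
  simp only [pd, h]
  exact deriv_const_mul_field _

end Wave

lemma slicePoint_update_one (r θ s : ℝ) :
    Function.update (slicePoint r θ) 1 s = slicePoint s θ := by
  ext i; fin_cases i <;> simp [slicePoint, Function.update]

lemma slicePoint_update_two (r θ s : ℝ) :
    Function.update (slicePoint r θ) 2 s = slicePoint r s := by
  ext i; fin_cases i <;> simp [slicePoint, Function.update]

/-- The `μ`-component of the densitized gradient `√(−det g) g^{μν} ∂_ν Ψ`. -/
def ringFlux (R : ℝ) (Ψ : (Fin 5 → ℝ) → ℂ) (μ : Fin 5) (y : Fin 5 → ℝ) : ℂ :=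
  ∑ ν : Fin 5, Complex.ofReal (Real.sqrt (-(ringMetric R y).det) * (ringMetric R y)⁻¹ μ ν) *
    pd ν Ψ y

/-- The maximum principle for separated waves: where `‖u‖` has a nonzero local maximum, the
potential `−ω²/a + (Kω − J)²/b + m²/D` is nonpositive, which bounds `m²` by `ω²`. -/
lemma sq_mul_le_of_boxRing_eq_zero {R ω m J : ℝ} {u : ℝ × ℝ → ℂ} {p : ℝ × ℝ}
    (hr : 6 < p.1) (hrR : p.1 < R) (hθ0 : 0 < p.2) (hθ : p.2 < Real.pi) (hup : u p ≠ 0)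
    (hmax : ∀ᶠ q in nhds p, ‖u q‖ ≤ ‖u p‖) (hu : ∀ᶠ q in nhds p, DifferentiableAt ℝ u q)
    (hbox : boxRing R (separatedWave ω m J u) (slicePoint p.1 p.2) = 0) :
    m ^ 2 * (1 + p.1 * Real.cos p.2 / R) ^ 2 ≤ 12 * R ^ 2 * ω ^ 2 := by
  set Ψ := separatedWave ω m J u with hΨ
  obtain ⟨r, θ⟩ := p
  simp only at *
  set x := slicePoint r θ with hx
  have hx1 : x 1 = r := rfl
  have hx2 : x 2 = θ := rfl
  have hΨx : Ψ x = u (r, θ) := by simp [hΨ, separatedWave, hx, slicePoint]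
  obtain ⟨a, K, b, A, B, D, ha, hb, hA, hB, hD, hDle, hM⟩ :=
    ringMetric_eq_blockMetric (R := R) (x := x) hr hrR hθ0 hθ
  have ha0 : 0 < a := by linarith
  have hinv := blockMetric_inv (K := K) ha0.ne' hb.ne' hA.ne' hB.ne' hD.ne'
  rw [← hM] at hinv
  set S := Real.sqrt (-(ringMetric R x).det) with hS
  have hSpos : 0 < S := by
    rw [hS, hM, blockMetric_det, neg_neg]
    positivity
  have hsum : ∑ μ : Fin 5, pd μ (ringFlux R Ψ μ) x = 0 :=
    (mul_eq_zero.1 hbox).resolve_left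
      (inv_ne_zero (Complex.ofReal_ne_zero.2 hSpos.ne'))
  have flux0 : ∀ y, y 1 = x 1 → y 2 = x 2 → ringFlux R Ψ 0 y =
      S * ((-a⁻¹ + K ^ 2 / b) * (Complex.I * (-ω : ℝ)) + K / b * (Complex.I * J)) * Ψ y := by
    intro y h1 h2
    simp only [ringFlux, Fin.sum_univ_five, ringMetric_congr h1 h2, hinv, ← hS, hΨ,
      pd_zero_separatedWave, pd_four_separatedWave]
    simp
    ring
  have flux3 : ∀ y, y 1 = x 1 → y 2 = x 2 → ringFlux R Ψ 3 y =
      S * (D⁻¹ * (Complex.I * m)) * Ψ y := by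
    intro y h1 h2
    simp only [ringFlux, Fin.sum_univ_five, ringMetric_congr h1 h2, hinv, ← hS, hΨ,
      pd_three_separatedWave]
    simp
    ring
  have flux4 : ∀ y, y 1 = x 1 → y 2 = x 2 → ringFlux R Ψ 4 y =
      S * (K / b * (Complex.I * (-ω : ℝ)) + b⁻¹ * (Complex.I * J)) * Ψ y := by
    intro y h1 h2
    simp only [ringFlux, Fin.sum_univ_five, ringMetric_congr h1 h2, hinv, ← hS, hΨ,
      pd_zero_separatedWave, pd_four_separatedWave]
    simp
    ring
  have d0 := pd_mul_congr (μ := 0) (x := x) fun s => flux0 (Function.update x 0 s) rfl rfl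
  have d3 := pd_mul_congr (μ := 3) (x := x) fun s => flux3 (Function.update x 3 s) rfl rfl
  have d4 := pd_mul_congr (μ := 4) (x := x) fun s => flux4 (Function.update x 4 s) rfl rfl
  rw [hΨ, pd_zero_separatedWave, ← hΨ, hΨx] at d0
  rw [hΨ, pd_three_separatedWave, ← hΨ, hΨx] at d3
  rw [hΨ, pd_four_separatedWave, ← hΨ, hΨx] at d4
  have hflux12 : ∀ s t, 6 < s → s < R → 0 < t → t < Real.pi →
      (0 < Real.sqrt (-(ringMetric R (slicePoint s t)).det) *
          (ringMetric R (slicePoint s t))⁻¹ 1 1 ∧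
        0 < Real.sqrt (-(ringMetric R (slicePoint s t)).det) *
          (ringMetric R (slicePoint s t))⁻¹ 2 2) ∧
      ringFlux R Ψ 1 (slicePoint s t) =
        Complex.ofReal (Real.sqrt (-(ringMetric R (slicePoint s t)).det) *
          (ringMetric R (slicePoint s t))⁻¹ 1 1) * deriv (fun s => u (s, t)) s ∧
      ringFlux R Ψ 2 (slicePoint s t) =
        Complex.ofReal (Real.sqrt (-(ringMetric R (slicePoint s t)).det) *
          (ringMetric R (slicePoint s t))⁻¹ 2 2) * deriv (fun t => u (s, t)) t := by
    intro s t h1 h2 h3 h4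
    obtain ⟨a, K, b, A, B, D, ha, hb, hA, hB, hD, -, hM⟩ :=
      ringMetric_eq_blockMetric (R := R) (x := slicePoint s t) h1 h2 h3 h4
    have ha0 : 0 < a := by linarith
    have hinv := blockMetric_inv (K := K) ha0.ne' hb.ne' hA.ne' hB.ne' hD.ne'
    refine ⟨?_, ?_, ?_⟩
    · rw [hM, hinv, blockMetric_det, neg_neg]
      have : 0 < Real.sqrt (a * b * A * B * D) := by positivity
      constructor <;> simp <;> positivity
    · simp only [ringFlux, Fin.sum_univ_five, hM, hinv, hΨ, pd_one_separatedWave_slicePoint]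
      simp
    · simp only [ringFlux, Fin.sum_univ_five, hM, hinv, hΨ, pd_two_separatedWave_slicePoint]
      simp
  have hc1 : Tendsto (fun s : ℝ => (s, θ)) (nhds r) (nhds (r, θ)) :=
    Continuous.tendsto (by fun_prop) r
  have hc2 : Tendsto (fun t : ℝ => (r, t)) (nhds θ) (nhds (r, θ)) :=
    Continuous.tendsto (by fun_prop) θ
  have hp1 : (star (u (r, θ)) * pd 1 (ringFlux R Ψ 1) x).re ≤ 0 := by
    have hev : ∀ᶠ s in nhds r, 6 < s ∧ s < R :=
      (lt_mem_nhds hr).and (gt_mem_nhds hrR)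
    simp only [pd, hx, slicePoint_update_one]
    refine re_conj_mul_deriv_nonpos (u := fun s => u (s, θ)) (hc1.eventually hmax) ?_ ?_ ?_
      (k := fun s => Real.sqrt (-(ringMetric R (slicePoint s θ)).det) *
          (ringMetric R (slicePoint s θ))⁻¹ 1 1)
    · filter_upwards [hc1.eventually hu] with s hs
      exact hs.comp s (by fun_prop : DifferentiableAt ℝ (fun s : ℝ => (s, θ)) s)
    · filter_upwards [hev] with s hs using (hflux12 s θ hs.1 hs.2 hθ0 hθ).1.1
    · filter_upwards [hev] with s hs using (hflux12 s θ hs.1 hs.2 hθ0 hθ).2.1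
  have hp2 : (star (u (r, θ)) * pd 2 (ringFlux R Ψ 2) x).re ≤ 0 := by
    have hev : ∀ᶠ t in nhds θ, 0 < t ∧ t < Real.pi :=
      (lt_mem_nhds hθ0).and (gt_mem_nhds hθ)
    simp only [pd, hx, slicePoint_update_two]
    refine re_conj_mul_deriv_nonpos (u := fun t => u (r, t)) (hc2.eventually hmax) ?_ ?_ ?_
      (k := fun t => Real.sqrt (-(ringMetric R (slicePoint r t)).det) *
          (ringMetric R (slicePoint r t))⁻¹ 2 2)
    · filter_upwards [hc2.eventually hu] with t ht
      exact ht.comp t (by fun_prop : DifferentiableAt ℝ (fun t : ℝ => (r, t)) t)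
    · filter_upwards [hev] with t ht using (hflux12 r t hr hrR ht.1 ht.2).1.2
    · filter_upwards [hev] with t ht using (hflux12 r t hr hrR ht.1 ht.2).2.2
  set V : ℝ := -(ω ^ 2 / a) + (K * ω - J) ^ 2 / b + m ^ 2 / D with hV
  have hsum' : pd 1 (ringFlux R Ψ 1) x + pd 2 (ringFlux R Ψ 2) x = (S * V : ℝ) * u (r, θ) := by
    rw [Fin.sum_univ_five, d0, d3, d4] at hsum
    rw [hV]
    push_cast at hsum ⊢
    linear_combination hsum - (S * u (r, θ) * (-(ω ^ 2 / a : ℂ) + (K * ω - J) ^ 2 / b + m ^ 2 / D)) *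
      Complex.I_sq
  have hVle : V ≤ 0 := by
    have h := add_nonpos hp1 hp2
    rw [← Complex.add_re, ← mul_add, hsum', mul_left_comm, Complex.re_ofReal_mul,
      Complex.star_def, ← Complex.normSq_eq_conj_mul_self, Complex.ofReal_re] at h
    have hn := Complex.normSq_pos.2 hup
    by_contra! hVpos
    have : 0 < S * V * Complex.normSq (u (r, θ)) := by positivity
    linarith
  have h1 : m ^ 2 / D ≤ 6 * ω ^ 2 := by
    have h2 : 0 ≤ (K * ω - J) ^ 2 / b := by positivity
    have h3 : ω ^ 2 / a ≤ 6 * ω ^ 2 := by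
      rw [div_le_iff₀ ha0]
      nlinarith [sq_nonneg ω]
    linarith
  rw [div_le_iff₀ hD] at h1
  rw [hx1, hx2] at hDle
  calc m ^ 2 * (1 + r * Real.cos θ / R) ^ 2
      ≤ 6 * ω ^ 2 * D * (1 + r * Real.cos θ / R) ^ 2 := by gcongr
    _ = 6 * ω ^ 2 * (D * (1 + r * Real.cos θ / R) ^ 2) := by ring
    _ ≤ 6 * ω ^ 2 * (2 * R ^ 2) := by gcongr
    _ = 12 * R ^ 2 * ω ^ 2 := by ring

/-- The potential does not vanish at the asymptotically flat end `(R, π)`. -/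
lemma WRing_infinity_ne_zero {R c κ : ℝ} (hR : 6 < R) (hκ : κ ≠ 0) :
    WRing R c κ (R, Real.pi) ≠ 0 := by
  have hk4 := two_mul_cosh_βRing_sq_lt R
  have hne : R - 2 * Real.cosh (βRing R) ^ 2 ≠ 0 := by linarith
  have hR0 : R ≠ 0 := by linarith
  have hR2 : R - 2 ≠ 0 := by linarith
  have h : WRing R c κ (R, Real.pi) = -((R - 2) / R) * κ ^ 2 := by
    simp only [WRing, f₁, f₂, f₃, f₄, Real.cos_pi, Real.sin_pi]
    have e : R + 2 * Real.cosh (βRing R) ^ 2 * -1 = R - 2 * Real.cosh (βRing R) ^ 2 := by ring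
    rw [e]
    simp
    left
    field_simp
  rw [h]
  exact mul_ne_zero (neg_ne_zero.2 (div_ne_zero hR2 hR0)) (pow_ne_zero 2 hκ)

/-- A set with the configuration of `RingGoodSet` stays away from the asymptotically flat
end. -/
lemma RingGoodSet.exists_pos_le {R c κ : ℝ} {Ω : Set (ℝ × ℝ)} (hκ : κ ≠ 0)
    (hΩ : RingGoodSet R (WRing R c κ) Ω) :
    ∃ δ > 0, ∀ p ∈ Ω, δ ≤ 1 + p.1 * Real.cos p.2 / R := by
  obtain ⟨hbd, hsub, ⟨p₀, hp₀, -⟩, hfr, -, h6⟩ := hΩ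
  have hR : 6 < R := (h6 p₀ hp₀).trans (hsub hp₀).1.2
  have hcl : closure Ω ⊆ Set.Icc 6 R ×ˢ Set.Icc 0 Real.pi :=
    closure_minimal (fun p hp => ⟨⟨(h6 p hp).le, (hsub hp).1.2.le⟩,
      ⟨(hsub hp).2.1.le, (hsub hp).2.2.le⟩⟩) (isClosed_Icc.prod isClosed_Icc)
  obtain ⟨q, hq, hmin⟩ := hbd.isCompact_closure.exists_isMinOn ⟨p₀, subset_closure hp₀⟩
    (f := fun p : ℝ × ℝ => 1 + p.1 * Real.cos p.2 / R)
    (by fun_prop)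
  refine ⟨_, ?_, fun p hp => hmin (subset_closure hp)⟩
  obtain ⟨⟨hq6, hqR⟩, hq0, hqπ⟩ := hcl hq
  have hcos := Real.neg_one_le_cos q.2
  by_contra! hle
  have hle' : q.1 * Real.cos q.2 ≤ -R := by
    have h : q.1 * Real.cos q.2 / R ≤ -1 := by linarith
    rw [div_le_iff₀ (by linarith)] at h
    linarith
  have hq1 : q.1 = R := by nlinarith
  have hq2 : q.2 = Real.pi := by
    refine Real.injOn_cos ⟨hq0, hqπ⟩ ⟨Real.pi_pos.le, le_rfl⟩ ?_
    rw [Real.cos_pi]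
    rw [hq1] at hle'
    nlinarith
  have hqe : q = (R, Real.pi) := Prod.ext hq1 hq2
  have hqfr : q ∈ frontier Ω :=
    ⟨hq, fun hi => (hsub (interior_subset hi)).1.2.ne hq1⟩
  exact WRing_infinity_ne_zero hR hκ (hqe ▸ hfr q hqfr)

lemma RingEigWith.exists_max {R m J ω : ℝ} {Ω : Set (ℝ × ℝ)} {u : ℝ × ℝ → ℂ}
    (hbd : Bornology.IsBounded Ω) (h : RingEigWith R Ω m J ω u) :
    ∃ p ∈ Ω, u p ≠ 0 ∧ (∀ᶠ q in nhds p, ‖u q‖ ≤ ‖u p‖) ∧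
      ∀ᶠ q in nhds p, DifferentiableAt ℝ u q := by
  obtain ⟨⟨U, hU, hΩU, hu⟩, ⟨p₀, hp₀, hup₀⟩, hfr, -⟩ := h
  obtain ⟨p, hp, hmax⟩ := hbd.isCompact_closure.exists_isMaxOn ⟨p₀, subset_closure hp₀⟩
    (hu.continuousOn.mono hΩU).norm
  have hup : u p ≠ 0 :=
    norm_pos_iff.1 ((norm_pos_iff.2 hup₀).trans_le (hmax (subset_closure hp₀)))
  have hpint : p ∈ interior Ω := by
    by_contra hn
    exact hup (hfr p ⟨hp, hn⟩)
  refine ⟨p, interior_subset hpint, hup, ?_, ?_⟩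
  · filter_upwards [mem_interior_iff_mem_nhds.1 hpint] with q hq using hmax (subset_closure hq)
  · filter_upwards [hU.mem_nhds (hΩU hp)] with q hq
    exact (hu.contDiffAt (hU.mem_nhds hq)).differentiableAt (by simp)

/-- Every ring Dirichlet eigenfrequency on `Ω` with frequencies
`(m, Ĵ = R·c·m)` satisfies `ω² ≥ C·m²` for `m²` large, with `C, M` independent of `m`. -/
theorem statement16 (R : ℝ) (hR : 2 < R)
    (c : ℚ) (hc0 : 0 < (c : ℝ) ^ 2) (hc : (c : ℝ) ^ 2 < 1 / 12)
    (ℰ E : ℝ) (hℰ : 0 < ℰ) (hE : 0 < E)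
    (Ω Ω' Ω'' Ω''' : Set (ℝ × ℝ))
    (hΩ : RingGoodSet R (WRing R (c : ℝ) ℰ) Ω) (hΩineq : RingIneqs R Ω)
    (hΩ' : RingGoodSet R (WRing R (c : ℝ) E) Ω') (hΩ'sub : Ω' ⊆ Ω)
    (hΩ'' : RingGoodSet R (WStr β₀ (c : ℝ) E) Ω'') (hΩ''sub : Ω'' ⊆ Ω)
    (hΩ''' : RingGoodSet R (WStr 0 (c : ℝ) E) Ω''') (hΩ'''sub : Ω''' ⊆ Ω) :
    ∃ C > (0 : ℝ), ∃ M > (0 : ℝ), ∀ m : ℤ, M < (m : ℝ) ^ 2 →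
      0 < R * (c : ℝ) * (m : ℝ) →
      ∀ ω : ℝ, RingEig R Ω (m : ℝ) (R * (c : ℝ) * (m : ℝ)) ω →
        C * (m : ℝ) ^ 2 ≤ ω ^ 2 := by
  obtain ⟨δ, hδ, hle⟩ := hΩ.exists_pos_le hℰ.ne'
  obtain ⟨hbd, hsub, -, -, -, h6⟩ := hΩ
  have hR0 : 0 < R := by linarith
  refine ⟨δ ^ 2 / (12 * R ^ 2), by positivity, 1, one_pos, fun m _ _ ω hω => ?_⟩
  obtain ⟨u, hu⟩ := hω
  obtain ⟨p, hp, hup, hmax, hdiff⟩ := hu.exists_max hbd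
  have h := sq_mul_le_of_boxRing_eq_zero (h6 p hp) (hsub hp).1.2 (hsub hp).2.1 (hsub hp).2.2
    hup hmax hdiff (hu.2.2.2 (slicePoint p.1 p.2) hp)
  rw [div_mul_eq_mul_div, div_le_iff₀ (by positivity)]
  have hδp := hle p hp
  calc δ ^ 2 * (m : ℝ) ^ 2 ≤ (1 + p.1 * Real.cos p.2 / R) ^ 2 * (m : ℝ) ^ 2 := by gcongr
    _ ≤ ω ^ 2 * (12 * R ^ 2) := by linarith
end
end
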